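/- For every T > 0, M ≥ 1, ε ∈ (0,1] and every real n ≥ 8, there exists a constant C > 0, depending only on M, ε, T and n, such that every smooth solution (v,u,θ,q) of the radiation hydrodynamics system on [0,T] with (M,ε)-bounded initial data satisfies, for all t ∈ [0,T]: (i) ‖v(t,·)‖_{L^∞} ≤ C(1 + 𝔜(t)^{𝔗₀(n,1,β)}); (ii) ‖u_x(t,·)‖ ≤ C(1 + 𝔜(t)^{𝔗₀(n,1/2,β)}) ℨ(t)^{1/4}; (iii) ‖u_x(t,·)‖_{L^∞} ≤ C(1 + 𝔜(t)^{𝔗₀(n,3/4,β)}) ℨ(t)^{3/8}; (iv) ‖u(t,·)‖² + ∫₀ᵗ ∫_𝕋 u_x²/v dx ds ≤ C(1 + 𝔜(t)^{𝔗₀(n,1,β)}); (v) ∫₀ᵗ (∫_𝕋 q_x²/v dx + ∫_𝕋 v q² dx) ds ≤ C(1 + 𝔜(t)^{𝔗₀(n,8,β)}); (vi) ‖θ(t,·)‖² + ∫₀ᵗ ∫_𝕋 κ(v,θ) θ_x²/v dx ds ≤ C(1 + 𝔜(t)^{𝔗₁(n,β)}). -/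

import Mathlib

open MeasureTheory Real Set

noncomputable section

namespace RadHydro

/-- Integral over one period `[-1/2, 1/2]` of the torus `𝕋 ≅ ℝ/ℤ`. -/
def tInt (f : ℝ → ℝ) : ℝ := ∫ x in (-(1/2) : ℝ)..(1/2 : ℝ), f x

/-- Squared `L²` norm over the torus. -/
def L2sq (f : ℝ → ℝ) : ℝ := tInt fun x => (f x) ^ 2

/-- `L^∞` norm over the torus. -/
def Linf (f : ℝ → ℝ) : ℝ := sSup ((fun x => |f x|) '' Icc (-(1/2) : ℝ) (1/2))

/-- Squared `H¹` norm over the torus. -/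
def H1sq (f : ℝ → ℝ) : ℝ := L2sq f + L2sq (deriv f)

/-- Squared `H²` norm over the torus. -/
def H2sq (f : ℝ → ℝ) : ℝ := L2sq f + L2sq (deriv f) + L2sq (deriv (deriv f))

/-- Partial derivative in the time variable. -/
def pt (f : ℝ → ℝ → ℝ) (t x : ℝ) : ℝ := deriv (fun s => f s x) t

/-- Partial derivative in the space variable. -/
def px (f : ℝ → ℝ → ℝ) (t x : ℝ) : ℝ := deriv (f t) x

/-- The heat conductivity `κ(v, θ) = κ₁ + κ₂ v θ^β`. -/
def kappa (κ₁ κ₂ β v θ : ℝ) : ℝ := κ₁ + κ₂ * v * θ ^ β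

/-- A smooth solution of the radiation hydrodynamics system (in Lagrangian
coordinates) on `[0, T]`: four `C^∞` functions on `[0,T] × ℝ` (modelled as smooth
functions on all of `ℝ × ℝ`), `1`-periodic in the space variable, with `v > 0`,
`θ > 0`, satisfying the four equations pointwise for `t ∈ [0, T]`, and with the
normalization `∫_𝕋 v(0, x) dx = 1`. -/
structure Sol (μ R a b κ₁ κ₂ β γ T : ℝ) where
  v : ℝ → ℝ → ℝ
  u : ℝ → ℝ → ℝ
  θ : ℝ → ℝ → ℝ
  q : ℝ → ℝ → ℝ
  smooth_v : ContDiff ℝ (⊤ : ℕ∞) fun p : ℝ × ℝ => v p.1 p.2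
  smooth_u : ContDiff ℝ (⊤ : ℕ∞) fun p : ℝ × ℝ => u p.1 p.2
  smooth_θ : ContDiff ℝ (⊤ : ℕ∞) fun p : ℝ × ℝ => θ p.1 p.2
  smooth_q : ContDiff ℝ (⊤ : ℕ∞) fun p : ℝ × ℝ => q p.1 p.2
  periodic_v : ∀ t, Function.Periodic (v t) 1
  periodic_u : ∀ t, Function.Periodic (u t) 1
  periodic_θ : ∀ t, Function.Periodic (θ t) 1
  periodic_q : ∀ t, Function.Periodic (q t) 1
  v_pos : ∀ t x, 0 < v t x
  θ_pos : ∀ t x, 0 < θ t x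
  eq_mass : ∀ t ∈ Icc (0 : ℝ) T, ∀ x : ℝ, pt v t x - px u t x = 0
  eq_mom : ∀ t ∈ Icc (0 : ℝ) T, ∀ x : ℝ,
    pt u t x + px (fun s y => R * θ s y / v s y) t x
      = px (fun s y => μ * px u s y / v s y) t x
  eq_energy : ∀ t ∈ Icc (0 : ℝ) T, ∀ x : ℝ,
    pt (fun s y => R / (γ - 1) * θ s y + (u s y) ^ 2 / 2) t x
      + px (fun s y => R * θ s y / v s y * u s y) t x + px q t x
      = px (fun s y => μ * u s y * px u s y / v s y) t x
        + px (fun s y => kappa κ₁ κ₂ β (v s y) (θ s y) * px θ s y / v s y) t x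
  eq_rad : ∀ t ∈ Icc (0 : ℝ) T, ∀ x : ℝ,
    -px (fun s y => px q s y / v s y) t x + a * v t x * q t x
      + b * px (fun s y => (θ s y) ^ 4) t x = 0
  mean_v : tInt (v 0) = 1

/-- `(M, ε)`-bounded initial data: `‖(v₀, u₀, θ₀)‖_{H²} ≤ M` and `v₀ ≥ ε`, `θ₀ ≥ ε`. -/
def DataBounded (M ε : ℝ) (v₀ u₀ θ₀ : ℝ → ℝ) : Prop :=
  Real.sqrt (H2sq v₀ + H2sq u₀ + H2sq θ₀) ≤ M ∧ (∀ x, ε ≤ v₀ x) ∧ ∀ x, ε ≤ θ₀ x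

variable {μ R a b κ₁ κ₂ β γ T : ℝ}

/-- A solution has `(M, ε)`-bounded initial data. -/
def Sol.Bounded (S : Sol μ R a b κ₁ κ₂ β γ T) (M ε : ℝ) : Prop :=
  DataBounded M ε (S.v 0) (S.u 0) (S.θ 0)

/-- The auxiliary function `𝔛(t) = ∫₀ᵗ ∫_𝕋 κ(v,θ) θ_t² / v dx ds`. -/
def Sol.X (S : Sol μ R a b κ₁ κ₂ β γ T) (t : ℝ) : ℝ :=
  ∫ s in (0 : ℝ)..t, tInt fun x =>
    kappa κ₁ κ₂ β (S.v s x) (S.θ s x) * (pt S.θ s x) ^ 2 / S.v s x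

/-- The auxiliary function `𝔜(t) = max_{0 ≤ s ≤ t} ∫_𝕋 κ(v,θ)² θ_x² / v² dx`. -/
def Sol.Y (S : Sol μ R a b κ₁ κ₂ β γ T) (t : ℝ) : ℝ :=
  sSup ((fun s => tInt fun x =>
    (kappa κ₁ κ₂ β (S.v s x) (S.θ s x)) ^ 2 * (px S.θ s x) ^ 2 / (S.v s x) ^ 2) ''
      Icc (0 : ℝ) t)

/-- The auxiliary function `ℨ(t) = max_{0 ≤ s ≤ t} ∫_𝕋 u_{xx}² / v² dx`. -/
def Sol.Z (S : Sol μ R a b κ₁ κ₂ β γ T) (t : ℝ) : ℝ :=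
  sSup ((fun s => tInt fun x => (px (px S.u) s x) ^ 2 / (S.v s x) ^ 2) '' Icc (0 : ℝ) t)

/-- The exponent `𝔗₀(n, p, β)`. -/
def T0 (n _p β : ℝ) : ℝ :=
  if n < (β + 3) / 2 then 4 / (n * (2 * β + 3)) else (n - β + 5) / (n * (2 * β + 3))

/-- The exponent `𝔗₁(n, β)`. -/
def T1 (n β : ℝ) : ℝ := max (T0 n 8 β) (1 / (2 * β + 3) + T0 n 1 β)

/-- The exponent `𝔘ʸ₁₁(n, β)`. -/
def Uy11 (n β : ℝ) : ℝ := 2 / (2 * β + 3) + T0 n 1 β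

/-- The exponent `𝔘ᶻ₁₁(n, β)`. -/
def Uz11 (n β : ℝ) : ℝ := 3 / 4 * (1 / (1 - T0 n (5/2) β))

/-- The exponent `𝔘ʸ₂(n, β)`. -/
def Uy2 (n β : ℝ) : ℝ := 2 / (2 * β + 3) + T1 n β

/-- The exponent `𝔘ᶻ₂(n, β)`. -/
def Uz2 (n β : ℝ) : ℝ := 3 / 4 * (1 / (1 - T0 n (3/2) β - T1 n β))

end RadHydro

namespace RadHydro

open scoped ContDiff

/-- Smooth functions of time and space that are `1`-periodic in space. -/
structure Sm (f : ℝ → ℝ → ℝ) : Prop where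
  smooth : ContDiff ℝ ∞ fun p : ℝ × ℝ => f p.1 p.2
  periodic : ∀ t x, f t (x + 1) = f t x

namespace Sm

variable {f g : ℝ → ℝ → ℝ}

theorem const (c : ℝ) : Sm fun _ _ => c := ⟨contDiff_const, fun _ _ => rfl⟩

theorem add (hf : Sm f) (hg : Sm g) : Sm fun t x => f t x + g t x :=
  ⟨hf.smooth.add hg.smooth, fun t x => by simp only [hf.periodic, hg.periodic]⟩

theorem sub (hf : Sm f) (hg : Sm g) : Sm fun t x => f t x - g t x :=
  ⟨hf.smooth.sub hg.smooth, fun t x => by simp only [hf.periodic, hg.periodic]⟩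

theorem mul (hf : Sm f) (hg : Sm g) : Sm fun t x => f t x * g t x :=
  ⟨hf.smooth.mul hg.smooth, fun t x => by simp only [hf.periodic, hg.periodic]⟩

theorem pow (hf : Sm f) (n : ℕ) : Sm fun t x => f t x ^ n :=
  ⟨hf.smooth.pow n, fun t x => by simp only [hf.periodic]⟩

theorem div (hf : Sm f) (hg : Sm g) (h : ∀ t x, 0 < g t x) : Sm fun t x => f t x / g t x :=
  ⟨hf.smooth.div hg.smooth fun p => (h p.1 p.2).ne',
    fun t x => by simp only [hf.periodic, hg.periodic]⟩

theorem rpow (hf : Sm f) (h : ∀ t x, 0 < f t x) (m : ℝ) : Sm fun t x => f t x ^ m :=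
  ⟨hf.smooth.rpow contDiff_const fun p => (h p.1 p.2).ne',
    fun t x => by simp only [hf.periodic]⟩

theorem hasFDerivAt (hf : Sm f) (t x : ℝ) :
    HasFDerivAt (fun p : ℝ × ℝ => f p.1 p.2)
      (fderiv ℝ (fun p : ℝ × ℝ => f p.1 p.2) (t, x)) (t, x) :=
  (hf.smooth.differentiable (by simp) _).hasFDerivAt

theorem hasDerivAt_px_aux (hf : Sm f) (t x : ℝ) :
    HasDerivAt (f t) (fderiv ℝ (fun p : ℝ × ℝ => f p.1 p.2) (t, x) (0, 1)) x := by
  have h := (hf.hasFDerivAt t x).comp_hasDerivAt x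
    ((hasDerivAt_const x t).prodMk (hasDerivAt_id x))
  exact h

theorem hasDerivAt_pt_aux (hf : Sm f) (t x : ℝ) :
    HasDerivAt (fun s => f s x) (fderiv ℝ (fun p : ℝ × ℝ => f p.1 p.2) (t, x) (1, 0)) t := by
  have h := (hf.hasFDerivAt t x).comp_hasDerivAt t
    ((hasDerivAt_id t).prodMk (hasDerivAt_const t x))
  exact h

theorem hasDerivAt_px (hf : Sm f) (t x : ℝ) : HasDerivAt (f t) (px f t x) x :=
  (hf.hasDerivAt_px_aux t x).differentiableAt.hasDerivAt

theorem hasDerivAt_pt (hf : Sm f) (t x : ℝ) : HasDerivAt (fun s => f s x) (pt f t x) t :=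
  (hf.hasDerivAt_pt_aux t x).differentiableAt.hasDerivAt

theorem px_eq (hf : Sm f) (t x : ℝ) :
    px f t x = fderiv ℝ (fun p : ℝ × ℝ => f p.1 p.2) (t, x) (0, 1) :=
  (hf.hasDerivAt_px_aux t x).deriv

theorem pt_eq (hf : Sm f) (t x : ℝ) :
    pt f t x = fderiv ℝ (fun p : ℝ × ℝ => f p.1 p.2) (t, x) (1, 0) :=
  (hf.hasDerivAt_pt_aux t x).deriv

theorem px (hf : Sm f) : Sm (px f) := by
  refine ⟨?_, fun t x => ?_⟩
  · have : (fun p : ℝ × ℝ => RadHydro.px f p.1 p.2)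
        = fun p => fderiv ℝ (fun p : ℝ × ℝ => f p.1 p.2) p (0, 1) := by
      ext p; exact hf.px_eq p.1 p.2
    rw [this]
    exact (hf.smooth.fderiv_right (m := ∞) (by simp)).clm_apply contDiff_const
  · unfold RadHydro.px
    rw [← deriv_comp_add_const]
    simp only [hf.periodic]

theorem pt (hf : Sm f) : Sm (pt f) := by
  refine ⟨?_, fun t x => ?_⟩
  · have : (fun p : ℝ × ℝ => RadHydro.pt f p.1 p.2)
        = fun p => fderiv ℝ (fun p : ℝ × ℝ => f p.1 p.2) p (1, 0) := by
      ext p; exact hf.pt_eq p.1 p.2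
    rw [this]
    exact (hf.smooth.fderiv_right (m := ∞) (by simp)).clm_apply contDiff_const
  · unfold RadHydro.pt
    simp only [hf.periodic]

theorem pt_px (hf : Sm f) (t x : ℝ) :
    RadHydro.pt (RadHydro.px f) t x = RadHydro.px (RadHydro.pt f) t x := by
  have hs : IsSymmSndFDerivAt ℝ (fun p : ℝ × ℝ => f p.1 p.2) (t, x) :=
    hf.smooth.contDiffAt.isSymmSndFDerivAt (by simpa using WithTop.coe_le_coe.2 (le_top (a := (2 : ℕ∞))))
  have hd : DifferentiableAt ℝ (fderiv ℝ fun p : ℝ × ℝ => f p.1 p.2) (t, x) :=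
    (hf.smooth.fderiv_right (m := ∞) (by simp)).differentiable (by simp) _
  have e1 : (fun p : ℝ × ℝ => RadHydro.px f p.1 p.2)
      = fun p => fderiv ℝ (fun p : ℝ × ℝ => f p.1 p.2) p (0, 1) := by
    ext p; exact hf.px_eq p.1 p.2
  have e2 : (fun p : ℝ × ℝ => RadHydro.pt f p.1 p.2)
      = fun p => fderiv ℝ (fun p : ℝ × ℝ => f p.1 p.2) p (1, 0) := by
    ext p; exact hf.pt_eq p.1 p.2
  rw [hf.px.pt_eq, hf.pt.px_eq, e1, e2,
    fderiv_clm_apply hd (differentiableAt_const _), fderiv_clm_apply hd (differentiableAt_const _)]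
  simpa using hs (1, 0) (0, 1)

theorem continuous (hf : Sm f) : Continuous (Function.uncurry f) := hf.smooth.continuous

theorem continuous_x (hf : Sm f) (t : ℝ) : Continuous (f t) :=
  hf.continuous.comp (Continuous.prodMk_right t)

theorem continuous_t (hf : Sm f) (x : ℝ) : Continuous fun t => f t x :=
  hf.continuous.comp (Continuous.prodMk_left x)

end Sm

/-! ### Integration over a period -/

/-- The fundamental period. -/
abbrev cell : Set ℝ := Icc (-(1 / 2)) (1 / 2)

section tInt

variable {f g : ℝ → ℝ}

theorem tInt_mono (hf : Continuous f) (hg : Continuous g) (h : ∀ x ∈ cell, f x ≤ g x) :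
    tInt f ≤ tInt g :=
  intervalIntegral.integral_mono_on (by norm_num) (hf.intervalIntegrable _ _)
    (hg.intervalIntegrable _ _) h

theorem tInt_nonneg (h : ∀ x ∈ cell, 0 ≤ f x) : 0 ≤ tInt f :=
  intervalIntegral.integral_nonneg (by norm_num) h

theorem tInt_const (c : ℝ) : (tInt fun _ => c) = c := by
  simp only [tInt, intervalIntegral.integral_const, smul_eq_mul]; ring

theorem tInt_add (hf : Continuous f) (hg : Continuous g) :
    (tInt fun x => f x + g x) = tInt f + tInt g :=
  intervalIntegral.integral_add (hf.intervalIntegrable _ _) (hg.intervalIntegrable _ _)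

theorem tInt_sub (hf : Continuous f) (hg : Continuous g) :
    (tInt fun x => f x - g x) = tInt f - tInt g :=
  intervalIntegral.integral_sub (hf.intervalIntegrable _ _) (hg.intervalIntegrable _ _)

theorem tInt_const_mul (c : ℝ) : (tInt fun x => c * f x) = c * tInt f :=
  intervalIntegral.integral_const_mul c _

theorem tInt_sq_le (hf : Continuous f) (hg : Continuous g) :
    (tInt fun x => f x * g x) ^ 2 ≤ (tInt fun x => f x ^ 2) * tInt fun x => g x ^ 2 := by
  have h := discrim_le_zero (a := tInt fun x => f x ^ 2) (b := 2 * tInt fun x => f x * g x)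
    (c := tInt fun x => g x ^ 2) fun s => by
      have h0 : 0 ≤ tInt fun x => (s * f x + g x) ^ 2 := tInt_nonneg fun x _ => sq_nonneg _
      have e : (tInt fun x => (s * f x + g x) ^ 2)
          = tInt fun x => (s * s) * f x ^ 2 + ((2 * s) * (f x * g x) + g x ^ 2) := by
        congr 1; ext x; ring
      rw [e, tInt_add (by fun_prop) (by fun_prop), tInt_add (by fun_prop) (by fun_prop),
        tInt_const_mul, tInt_const_mul] at h0
      linarith
  rw [discrim] at h
  linarith

theorem exists_le_tInt (hf : Continuous f) : ∃ y ∈ cell, f y ≤ tInt f := by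
  obtain ⟨y, hy, hmin⟩ := (isCompact_Icc (a := (-(1 / 2) : ℝ)) (b := 1 / 2)).exists_isMinOn
    (nonempty_Icc.2 (by norm_num)) hf.continuousOn
  refine ⟨y, hy, ?_⟩
  rw [← tInt_const (f y)]
  exact tInt_mono continuous_const hf fun x hx => hmin hx

theorem tInt_abs_le (hf : Continuous f) : (tInt fun x => |f x|) ≤ 1 + tInt fun x => f x ^ 2 := by
  rw [← tInt_const 1, ← tInt_add continuous_const (by fun_prop)]
  refine tInt_mono (by fun_prop) (by fun_prop) fun x _ => ?_
  nlinarith [sq_nonneg (|f x| - 1), sq_abs (f x)]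

theorem abs_intervalIntegral_le_tInt (hf : Continuous f) {x y : ℝ} (hx : x ∈ cell) (hy : y ∈ cell) :
    |∫ z in x..y, f z| ≤ tInt fun z => |f z| := by
  have h1 := intervalIntegral.norm_integral_le_integral_norm_uIoc (f := f) (a := x) (b := y)
    (μ := volume)
  refine h1.trans ?_
  rw [tInt, intervalIntegral.integral_of_le (by norm_num)]
  refine setIntegral_mono_set ?_ (Filter.Eventually.of_forall fun z => abs_nonneg _) ?_
  · exact (hf.abs.integrableOn_Icc).mono_set Ioc_subset_Icc_self
  · refine LE.le.eventuallyLE ?_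
    exact Ioc_subset_Ioc (le_min hx.1 hy.1) (max_le hx.2 hy.2)

theorem sub_le_tInt_abs_deriv (hd : ∀ x, HasDerivAt f (g x) x) (hg : Continuous g) {x y : ℝ}
    (hx : x ∈ cell) (hy : y ∈ cell) : f x - f y ≤ tInt fun z => |g z| := by
  rw [← intervalIntegral.integral_eq_sub_of_hasDerivAt (fun z _ => hd z)
    (hg.intervalIntegrable _ _)]
  exact (le_abs_self _).trans (abs_intervalIntegral_le_tInt hg hy hx)

end tInt

theorem continuous_tInt {f : ℝ → ℝ → ℝ} (hf : Continuous (Function.uncurry f)) :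
    Continuous fun t => tInt (f t) :=
  intervalIntegral.continuous_parametric_intervalIntegral_of_continuous' hf _ _

/-- Differentiation under the integral sign. -/
theorem hasDerivAt_intervalIntegral {f f' : ℝ → ℝ → ℝ} (hc : ∀ t, Continuous (f t))
    (hd : ∀ t x, HasDerivAt (fun s => f s x) (f' t x) t)
    (hf' : Continuous (Function.uncurry f')) (x₀ x₁ t : ℝ) :
    HasDerivAt (fun s => ∫ x in x₀..x₁, f s x) (∫ x in x₀..x₁, f' t x) t := by
  obtain ⟨B, hB⟩ := ((isCompact_Icc (a := t - 1) (b := t + 1)).prod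
    (isCompact_uIcc (a := x₀) (b := x₁))).exists_bound_of_continuousOn
    hf'.continuousOn
  have hc' : ∀ t, Continuous (f' t) := fun t => hf'.comp (Continuous.prodMk_right t)
  refine (intervalIntegral.hasDerivAt_integral_of_dominated_loc_of_deriv_le (bound := fun _ => B)
    (Icc_mem_nhds (a := t - 1) (b := t + 1) (by linarith) (by linarith)) ?_
    ((hc t).intervalIntegrable _ _) (hc' t).aestronglyMeasurable ?_ (by simp) ?_).2
  · exact Filter.Eventually.of_forall fun s => (hc s).aestronglyMeasurable
  · exact Filter.Eventually.of_forall fun x hx s hs => hB (s, x) ⟨hs, uIoc_subset_uIcc hx⟩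
  · exact Filter.Eventually.of_forall fun x _ s _ => hd s x

namespace Sm

variable {f : ℝ → ℝ → ℝ}

theorem hasDerivAt_tInt (hf : Sm f) (t : ℝ) :
    HasDerivAt (fun s => tInt (f s)) (tInt (RadHydro.pt f t)) t :=
  hasDerivAt_intervalIntegral hf.continuous_x hf.hasDerivAt_pt hf.pt.continuous _ _ t

theorem continuous_tInt (hf : Sm f) : Continuous fun t => tInt (f t) :=
  RadHydro.continuous_tInt hf.continuous

theorem tInt_px (hf : Sm f) (t : ℝ) : tInt (RadHydro.px f t) = 0 := by
  rw [tInt, intervalIntegral.integral_eq_sub_of_hasDerivAt (fun x _ => hf.hasDerivAt_px t x)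
    ((hf.px.continuous_x t).intervalIntegrable _ _), sub_eq_zero]
  have := hf.periodic t (-(1 / 2))
  norm_num at this ⊢
  exact this

end Sm

/-- The derivative of a time primitive. -/
theorem hasDerivAt_primitive {f : ℝ → ℝ} (hf : Continuous f) (t : ℝ) :
    HasDerivAt (fun s => ∫ r in (0 : ℝ)..s, f r) (f t) t :=
  (hf.integral_hasStrictDerivAt 0 t).hasDerivAt

/-- Integration of a differential inequality. -/
theorem sub_le_integral {F F' G : ℝ → ℝ} {T : ℝ} (hF : ∀ t, HasDerivAt F (F' t) t)
    (hF' : Continuous F') (hG : Continuous G) (h : ∀ t ∈ Icc 0 T, F' t ≤ G t) {t : ℝ}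
    (ht : t ∈ Icc 0 T) : F t - F 0 ≤ ∫ s in (0 : ℝ)..t, G s := by
  rw [← intervalIntegral.integral_eq_sub_of_hasDerivAt (fun z _ => hF z)
    (hF'.intervalIntegrable _ _)]
  exact intervalIntegral.integral_mono_on ht.1 (hF'.intervalIntegrable _ _)
    (hG.intervalIntegrable _ _) fun s hs => h s ⟨hs.1, hs.2.trans ht.2⟩

/-- Integration of a differential inequality with a dissipation term. -/
theorem add_integral_le {F F' D G : ℝ → ℝ} {T : ℝ} (hF : ∀ t, HasDerivAt F (F' t) t)
    (hF' : Continuous F') (hD : Continuous D) (hG : Continuous G)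
    (h : ∀ t ∈ Icc 0 T, F' t + D t ≤ G t) {t : ℝ} (ht : t ∈ Icc 0 T) :
    F t + ∫ s in (0 : ℝ)..t, D s ≤ F 0 + ∫ s in (0 : ℝ)..t, G s := by
  have h1 := sub_le_integral (T := T) (G := fun s => G s - D s) hF hF' (hG.sub hD) (fun s hs => by
    linarith [h s hs]) ht
  rw [intervalIntegral.integral_sub (hG.intervalIntegrable _ _) (hD.intervalIntegrable _ _)] at h1
  linarith

theorem integral_const_mul_one_add {g : ℝ → ℝ} (hg : Continuous g) (c t : ℝ) :
    ∫ s in (0 : ℝ)..t, c * (1 + g s) = c * (t + ∫ s in (0 : ℝ)..t, g s) := by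
  rw [intervalIntegral.integral_const_mul, intervalIntegral.integral_add
    (by simp) (hg.intervalIntegrable _ _)]
  simp

variable {μ R a b κ₁ κ₂ β γ T M ε : ℝ}

/-- The standing sign conditions on the parameters. -/
structure PosParams (μ R a b κ₁ κ₂ β γ T M ε : ℝ) : Prop where
  hμ : 0 < μ
  hR : 0 < R
  ha : 0 < a
  hb : 0 < b
  hκ₁ : 0 < κ₁
  hκ₂ : 0 < κ₂
  hβ : 0 < β
  hγ : 1 < γ
  hT : 0 < T
  hM : 1 ≤ M
  hε : 0 < ε

theorem PosParams.cv_pos (P : PosParams μ R a b κ₁ κ₂ β γ T M ε) : 0 < R / (γ - 1) :=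
  div_pos P.hR (by linarith [P.hγ])

namespace Sol

variable (S : Sol μ R a b κ₁ κ₂ β γ T)

theorem smv : Sm S.v := ⟨S.smooth_v, S.periodic_v⟩
theorem smu : Sm S.u := ⟨S.smooth_u, S.periodic_u⟩
theorem smθ : Sm S.θ := ⟨S.smooth_θ, S.periodic_θ⟩
theorem smq : Sm S.q := ⟨S.smooth_q, S.periodic_q⟩

/-- The conductivity along a solution. -/
def cond (t x : ℝ) : ℝ := kappa κ₁ κ₂ β (S.v t x) (S.θ t x)

/-- The conductive heat flux `κ θ_x / v`. -/
def flux (t x : ℝ) : ℝ := S.cond t x * px S.θ t x / S.v t x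

theorem sm_cond : Sm S.cond :=
  (Sm.const κ₁).add (((Sm.const κ₂).mul S.smv).mul (S.smθ.rpow S.θ_pos β))

theorem sm_flux : Sm S.flux := (S.sm_cond.mul S.smθ.px).div S.smv S.v_pos

theorem cond_nonneg (P : PosParams μ R a b κ₁ κ₂ β γ T M ε) (t x : ℝ) : 0 < S.cond t x := by
  have h1 := P.hκ₁
  have h2 := P.hκ₂
  have h3 := S.v_pos t x
  have h4 := rpow_pos_of_pos (S.θ_pos t x) β
  unfold cond kappa
  positivity

theorem pt_v {t : ℝ} (ht : t ∈ Icc 0 T) (x : ℝ) : pt S.v t x = px S.u t x :=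
  sub_eq_zero.1 (S.eq_mass t ht x)

/-- The effective viscous flux `μ u_x / v - R θ / v`. -/
def stress (t x : ℝ) : ℝ := μ * px S.u t x / S.v t x - R * S.θ t x / S.v t x

theorem sm_stress : Sm S.stress :=
  (((Sm.const μ).mul S.smu.px).div S.smv S.v_pos).sub (((Sm.const R).mul S.smθ).div S.smv S.v_pos)

theorem px_viscous (t x : ℝ) : px (fun s y => μ * px S.u s y / S.v s y) t x
    = μ * px (px S.u) t x / S.v t x - μ * px S.u t x * px S.v t x / S.v t x ^ 2 := by
  have hv := (S.v_pos t x).ne'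
  refine ((((S.smu.px.hasDerivAt_px t x).const_mul μ).div (S.smv.hasDerivAt_px t x)
    hv).deriv).trans ?_
  field_simp

theorem px_pressure (t x : ℝ) : px (fun s y => R * S.θ s y / S.v s y) t x
    = R * px S.θ t x / S.v t x - R * S.θ t x * px S.v t x / S.v t x ^ 2 := by
  have hv := (S.v_pos t x).ne'
  refine ((((S.smθ.hasDerivAt_px t x).const_mul R).div (S.smv.hasDerivAt_px t x)
    hv).deriv).trans ?_
  field_simp

theorem pt_u {t : ℝ} (ht : t ∈ Icc 0 T) (x : ℝ) : pt S.u t x =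
    μ * px (px S.u) t x / S.v t x - μ * px S.u t x * px S.v t x / S.v t x ^ 2
      - (R * px S.θ t x / S.v t x - R * S.θ t x * px S.v t x / S.v t x ^ 2) := by
  have h := S.eq_mom t ht x
  rw [px_viscous, px_pressure] at h
  linarith

theorem px_stress {t : ℝ} (ht : t ∈ Icc 0 T) (x : ℝ) : px S.stress t x = pt S.u t x := by
  have h1 : Sm fun s y => μ * px S.u s y / S.v s y := ((Sm.const μ).mul S.smu.px).div S.smv S.v_pos
  have h2 : Sm fun s y => R * S.θ s y / S.v s y := ((Sm.const R).mul S.smθ).div S.smv S.v_pos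
  have h := ((h1.hasDerivAt_px t x).sub (h2.hasDerivAt_px t x)).deriv
  rw [S.pt_u ht, ← px_viscous, ← px_pressure, ← h]
  rfl

/-- The temperature equation. -/
theorem pt_θ {t : ℝ} (ht : t ∈ Icc 0 T) (x : ℝ) : R / (γ - 1) * pt S.θ t x =
    μ * px S.u t x ^ 2 / S.v t x - R * S.θ t x * px S.u t x / S.v t x - px S.q t x
      + px S.flux t x := by
  have h := S.eq_energy t ht x
  have h1 : Sm fun s y => μ * px S.u s y / S.v s y := ((Sm.const μ).mul S.smu.px).div S.smv S.v_pos
  have h2 : Sm fun s y => R * S.θ s y / S.v s y := ((Sm.const R).mul S.smθ).div S.smv S.v_pos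
  have e1 : pt (fun s y => R / (γ - 1) * S.θ s y + (S.u s y) ^ 2 / 2) t x
      = R / (γ - 1) * pt S.θ t x + S.u t x * pt S.u t x := by
    refine ((((S.smθ.hasDerivAt_pt t x).const_mul _).add
      (((S.smu.hasDerivAt_pt t x).pow 2).div_const 2)).deriv).trans ?_
    norm_num; ring
  have e2 : px (fun s y => R * S.θ s y / S.v s y * S.u s y) t x
      = px (fun s y => R * S.θ s y / S.v s y) t x * S.u t x + R * S.θ t x / S.v t x * px S.u t x :=
    ((h2.hasDerivAt_px t x).mul (S.smu.hasDerivAt_px t x)).deriv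
  have e3 : px (fun s y => μ * S.u s y * px S.u s y / S.v s y) t x
      = px (fun s y => μ * px S.u s y / S.v s y) t x * S.u t x
        + μ * px S.u t x / S.v t x * px S.u t x := by
    rw [← ((h1.hasDerivAt_px t x).mul (S.smu.hasDerivAt_px t x)).deriv]
    unfold px
    congr 1; ext y; simp only [Pi.mul_apply]; ring
  have e4 : px (fun s y => kappa κ₁ κ₂ β (S.v s y) (S.θ s y) * px S.θ s y / S.v s y) t x
      = px S.flux t x := rfl
  rw [e1, e2, e3, e4] at h
  have hm := S.eq_mom t ht x
  linear_combination h - S.u t x * hm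

/-! ### The radiation equation -/

/-- The radiation energy density `b θ⁴ - q_x / v`. -/
def rad (t x : ℝ) : ℝ := b * S.θ t x ^ 4 - px S.q t x / S.v t x

theorem sm_rad : Sm S.rad :=
  ((Sm.const b).mul (S.smθ.pow 4)).sub (S.smq.px.div S.smv S.v_pos)

theorem px_q (t x : ℝ) : px S.q t x = S.v t x * (b * S.θ t x ^ 4 - S.rad t x) := by
  have hv := (S.v_pos t x).ne'
  unfold rad
  field_simp
  ring

theorem px_rad {t : ℝ} (ht : t ∈ Icc 0 T) (x : ℝ) :
    px S.rad t x = -(a * S.v t x * S.q t x) := by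
  have h := S.eq_rad t ht x
  have h1 : Sm fun s y => px S.q s y / S.v s y := S.smq.px.div S.smv S.v_pos
  have e := (((S.smθ.pow 4).hasDerivAt_px t x).const_mul b).sub (h1.hasDerivAt_px t x)
  have e' : px S.rad t x = _ := e.deriv
  rw [e']
  linarith

theorem rad_pos (P : PosParams μ R a b κ₁ κ₂ β γ T M ε) {t : ℝ} (ht : t ∈ Icc 0 T) (x : ℝ) :
    0 < S.rad t x := by
  obtain ⟨y, hy, hmin⟩ := (isCompact_Icc (a := (0 : ℝ)) (b := 1)).exists_isMinOn
    (nonempty_Icc.2 (by norm_num)) (S.sm_rad.continuous_x t).continuousOn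
  have hglob : ∀ z, S.rad t y ≤ S.rad t z := fun z => by
    have hp : Function.Periodic (S.rad t) 1 := S.sm_rad.periodic t
    have : S.rad t (Int.fract z) = S.rad t z := by
      have := hp.sub_int_mul_eq (x := z) ⌊z⌋
      rw [mul_one] at this
      exact this
    rw [← this]
    exact hmin ⟨Int.fract_nonneg z, (Int.fract_lt_one z).le⟩
  have ha := P.ha
  have hb := P.hb
  refine lt_of_lt_of_le ?_ (hglob x)
  by_contra hneg
  push Not at hneg
  have hq : S.q t y = 0 := by
    have h0 : px S.rad t y = 0 :=
      (IsLocalMin.hasDerivAt_eq_zero (Filter.Eventually.of_forall hglob) (S.sm_rad.hasDerivAt_px t y))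
    rw [S.px_rad ht, neg_eq_zero] at h0
    have := S.v_pos t y
    have h1 : a * S.v t y ≠ 0 := by positivity
    exact (mul_eq_zero.1 h0).resolve_left h1
  have hqx : 0 < px S.q t y := by
    rw [S.px_q]
    have := S.θ_pos t y
    have : 0 < b * S.θ t y ^ 4 := by positivity
    exact mul_pos (S.v_pos t y) (by linarith)
  have hpos : ∀ᶠ z in nhdsWithin y (Ioi y), 0 < S.q t z := by
    have hs := (hasDerivAt_iff_tendsto_slope.1 (S.smq.hasDerivAt_px t y)).eventually_const_lt hqx
    have hle : nhdsWithin y (Ioi y) ≤ nhdsWithin y {y}ᶜ :=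
      nhdsWithin_mono _ fun z hz => ne_of_gt hz
    filter_upwards [hle hs, self_mem_nhdsWithin] with z hz hyz
    rw [slope_def_field, hq, sub_zero] at hz
    have hyz' : y < z := hyz
    exact (div_pos_iff_of_pos_right (by linarith)).1 hz
  obtain ⟨c, hc, hcpos⟩ := (mem_nhdsGT_iff_exists_Ioo_subset).1 hpos
  have hyc : y < (y + c) / 2 := by have : y < c := hc; linarith
  obtain ⟨z, hz, hzd⟩ := exists_hasDerivAt_eq_slope (S.rad t) (px S.rad t) hyc
    (S.sm_rad.continuous_x t).continuousOn fun z _ => S.sm_rad.hasDerivAt_px t z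
  have hzq : 0 < S.q t z := hcpos ⟨hz.1, by have : y < c := hc; linarith [hz.2]⟩
  have h1 : 0 ≤ px S.rad t z := by
    rw [hzd]
    exact div_nonneg (sub_nonneg.2 (hglob _)) (by linarith)
  rw [S.px_rad ht] at h1
  have := S.v_pos t z
  have : 0 < a * S.v t z * S.q t z := by positivity
  linarith

theorem rpow_sub_mul_nonneg {x y : ℝ} (hx : 0 < x) (hy : 0 < y) (m : ℝ) :
    0 ≤ m * ((x ^ 4 - y) * (x ^ m - y ^ (m / 4))) := by
  have e : x ^ m = (x ^ 4) ^ (m / 4) := by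
    rw [← rpow_natCast x 4, ← rpow_mul hx.le]
    congr 1; push_cast; ring
  rw [e]
  have h4 : 0 < x ^ 4 := by positivity
  generalize x ^ 4 = z at h4
  rcases le_total 0 m with hm | hm
  · refine mul_nonneg hm ?_
    rcases le_total z y with h | h
    · exact mul_nonneg_of_nonpos_of_nonpos (by linarith)
        (by linarith [rpow_le_rpow h4.le h (by positivity : 0 ≤ m / 4)])
    · exact mul_nonneg (by linarith)
        (by linarith [rpow_le_rpow hy.le h (by positivity : 0 ≤ m / 4)])
  · refine mul_nonneg_of_nonpos_of_nonpos hm ?_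
    rcases le_total z y with h | h
    · exact mul_nonpos_of_nonpos_of_nonneg (by linarith)
        (by linarith [rpow_le_rpow_of_nonpos h4 h (by linarith : m / 4 ≤ 0)])
    · exact mul_nonpos_of_nonneg_of_nonpos (by linarith)
        (by linarith [rpow_le_rpow_of_nonpos hy h (by linarith : m / 4 ≤ 0)])

/-- Radiative exchange is dissipative when tested against any power of the temperature. -/
theorem tInt_rpow_mul_px_q (P : PosParams μ R a b κ₁ κ₂ β γ T M ε) {t : ℝ} (ht : t ∈ Icc 0 T)
    (m : ℝ) : 0 ≤ m * tInt fun x => S.θ t x ^ m * px S.q t x := by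
  have ha := P.ha
  have hb := P.hb
  have hr := S.rad_pos P ht
  have hη : ∀ x, 0 < S.rad t x / b := fun x => div_pos (hr x) hb
  have hζ : ∀ x, HasDerivAt (fun y => S.q t y * (S.rad t y / b) ^ (m / 4))
      (px S.q t x * (S.rad t x / b) ^ (m / 4)
        + S.q t x * (-(a * S.v t x * S.q t x) / b * (m / 4) * (S.rad t x / b) ^ (m / 4 - 1))) x :=
    fun x => by
      have h1 := ((S.sm_rad.hasDerivAt_px t x).div_const b).rpow_const (p := m / 4)
        (Or.inl (hη x).ne')
      rw [S.px_rad ht] at h1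
      exact (S.smq.hasDerivAt_px t x).mul h1
  have hc : ∀ p : ℝ, Continuous fun x => (S.rad t x / b) ^ p := fun p =>
    ((S.sm_rad.continuous_x t).div_const b).rpow_const fun x => Or.inl (hη x).ne'
  have c1 := S.smq.continuous_x t
  have c2 := S.smq.px.continuous_x t
  have c3 := S.smv.continuous_x t
  have c4 := (S.smθ.rpow S.θ_pos m).continuous_x t
  have c5 := hc (m / 4)
  have c6 := hc (m / 4 - 1)
  have hcont : Continuous fun x => px S.q t x * (S.rad t x / b) ^ (m / 4)
        + S.q t x * (-(a * S.v t x * S.q t x) / b * (m / 4) * (S.rad t x / b) ^ (m / 4 - 1)) := by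
    fun_prop
  have hzero : (tInt fun x => px S.q t x * (S.rad t x / b) ^ (m / 4)
        + S.q t x * (-(a * S.v t x * S.q t x) / b * (m / 4) * (S.rad t x / b) ^ (m / 4 - 1)))
        = 0 := by
    rw [tInt, intervalIntegral.integral_eq_sub_of_hasDerivAt (fun x _ => hζ x)
      (hcont.intervalIntegrable _ _), sub_eq_zero]
    have e1 := S.smq.periodic t (-(1 / 2))
    have e2 := S.sm_rad.periodic t (-(1 / 2))
    norm_num at e1 e2 ⊢
    rw [e1, e2]
  have key : 0 ≤ tInt fun x => m * (S.θ t x ^ m * px S.q t x) -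
      m * (px S.q t x * (S.rad t x / b) ^ (m / 4)
        + S.q t x * (-(a * S.v t x * S.q t x) / b * (m / 4) * (S.rad t x / b) ^ (m / 4 - 1))) := by
    refine tInt_nonneg fun x _ => ?_
    have h1 := rpow_sub_mul_nonneg (S.θ_pos t x) (hη x) m
    have h2 : px S.q t x = S.v t x * b * (S.θ t x ^ 4 - S.rad t x / b) := by
      rw [S.px_q]; field_simp
    have hv := S.v_pos t x
    have hp := rpow_pos_of_pos (hη x) (m / 4 - 1)
    have h3 : 0 ≤ S.v t x * b * (m * ((S.θ t x ^ 4 - S.rad t x / b) *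
      (S.θ t x ^ m - (S.rad t x / b) ^ (m / 4)))) := mul_nonneg (by positivity) h1
    have h4 : 0 ≤ m ^ 2 / 4 * a * S.v t x * S.q t x ^ 2 / b * (S.rad t x / b) ^ (m / 4 - 1) := by
      positivity
    have e : m * (S.θ t x ^ m * px S.q t x) -
      m * (px S.q t x * (S.rad t x / b) ^ (m / 4)
        + S.q t x * (-(a * S.v t x * S.q t x) / b * (m / 4) * (S.rad t x / b) ^ (m / 4 - 1)))
      = S.v t x * b * (m * ((S.θ t x ^ 4 - S.rad t x / b) *
      (S.θ t x ^ m - (S.rad t x / b) ^ (m / 4)))) +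
      m ^ 2 / 4 * a * S.v t x * S.q t x ^ 2 / b * (S.rad t x / b) ^ (m / 4 - 1) := by
      rw [h2]; ring
    rw [e]; positivity
  rw [tInt_sub (by fun_prop) (hcont.const_mul m), tInt_const_mul, tInt_const_mul, hzero] at key
  linarith

/-! ### Integral identities -/

theorem sm_dissip : Sm fun t x => px S.u t x ^ 2 / S.v t x := (S.smu.px.pow 2).div S.smv S.v_pos

theorem sm_q_dissip : Sm fun t x => px S.q t x ^ 2 / S.v t x := (S.smq.px.pow 2).div S.smv S.v_pos

theorem tInt_q_le {t : ℝ} (ht : t ∈ Icc 0 T) :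
    (tInt fun x => px S.q t x ^ 2 / S.v t x) + 2 * a * (tInt fun x => S.v t x * S.q t x ^ 2)
      ≤ b ^ 2 * tInt fun x => S.v t x * S.θ t x ^ 8 := by
  have c1 := S.smq.continuous_x t
  have c2 := S.smq.px.continuous_x t
  have c3 := S.smv.continuous_x t
  have c4 := S.smθ.continuous_x t
  have c5 := S.sm_q_dissip.continuous_x t
  have h := (S.smq.mul S.sm_rad).tInt_px t
  have e : px (fun t x => S.q t x * S.rad t x) t = fun x =>
      b * (S.θ t x ^ 4 * px S.q t x) - px S.q t x ^ 2 / S.v t x - a * (S.v t x * S.q t x ^ 2) := by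
    ext x
    refine (((S.smq.hasDerivAt_px t x).mul (S.sm_rad.hasDerivAt_px t x)).deriv).trans ?_
    rw [S.px_rad ht]
    unfold rad
    ring
  rw [e, tInt_sub (by fun_prop) (by fun_prop), tInt_sub (by fun_prop) (by fun_prop),
    tInt_const_mul, tInt_const_mul] at h
  have h2 : (tInt fun x => b * (S.θ t x ^ 4 * px S.q t x)) ≤ tInt fun x =>
      (1 / 2) * (px S.q t x ^ 2 / S.v t x) + (b ^ 2 / 2) * (S.v t x * S.θ t x ^ 8) := by
    refine tInt_mono (by fun_prop) (by fun_prop) fun x _ => ?_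
    have hv := S.v_pos t x
    have : (1 / 2) * (px S.q t x ^ 2 / S.v t x) + (b ^ 2 / 2) * (S.v t x * S.θ t x ^ 8)
        - b * (S.θ t x ^ 4 * px S.q t x)
        = (px S.q t x - b * S.v t x * S.θ t x ^ 4) ^ 2 / (2 * S.v t x) := by
      field_simp; ring
    have : 0 ≤ (px S.q t x - b * S.v t x * S.θ t x ^ 4) ^ 2 / (2 * S.v t x) := by positivity
    linarith
  rw [tInt_add (by fun_prop) (by fun_prop), tInt_const_mul, tInt_const_mul, tInt_const_mul] at h2
  linarith

theorem tInt_rpow_mul_pt_θ {t : ℝ} (ht : t ∈ Icc 0 T) (m : ℝ) :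
    R / (γ - 1) * (tInt fun x => S.θ t x ^ m * pt S.θ t x) =
      (tInt fun x => S.θ t x ^ m * (μ * px S.u t x ^ 2 / S.v t x
        - R * S.θ t x * px S.u t x / S.v t x))
      - (tInt fun x => S.θ t x ^ m * px S.q t x)
      - m * tInt fun x => S.θ t x ^ (m - 1) * px S.θ t x * S.flux t x := by
  have hf : Sm fun t x => μ * px S.u t x ^ 2 / S.v t x - R * S.θ t x * px S.u t x / S.v t x :=
    (((Sm.const μ).mul (S.smu.px.pow 2)).div S.smv S.v_pos).sub
      ((((Sm.const R).mul S.smθ).mul S.smu.px).div S.smv S.v_pos)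
  have c0 := hf.continuous_x t
  have c1 := (S.smθ.rpow S.θ_pos m).continuous_x t
  have c2 := (S.smθ.rpow S.θ_pos (m - 1)).continuous_x t
  have c3 := S.smθ.px.continuous_x t
  have c4 := S.sm_flux.continuous_x t
  have c5 := S.smq.px.continuous_x t
  have hsm := (S.smθ.rpow S.θ_pos m).mul S.sm_flux
  have h := hsm.tInt_px t
  have c6 := hsm.px.continuous_x t
  refine Eq.trans ?_ (add_zero _)
  rw [← h, ← tInt_const_mul, ← tInt_const_mul, ← tInt_sub (by fun_prop) (by fun_prop),
    ← tInt_sub (by fun_prop) (by fun_prop), ← tInt_add (by fun_prop) (by fun_prop)]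
  congr 1
  ext x
  have e : px (fun t x => S.θ t x ^ m * S.flux t x) t x =
      px S.θ t x * m * S.θ t x ^ (m - 1) * S.flux t x + S.θ t x ^ m * px S.flux t x :=
    ((((S.smθ.hasDerivAt_px t x).rpow_const (p := m) (Or.inl (S.θ_pos t x).ne'))).mul
      (S.sm_flux.hasDerivAt_px t x)).deriv
  rw [e]
  have := S.pt_θ ht x
  linear_combination S.θ t x ^ m * this

theorem hasDerivAt_tInt_rpow (m t : ℝ) :
    HasDerivAt (fun s => tInt fun x => S.θ s x ^ (m + 1))
      ((m + 1) * tInt fun x => S.θ t x ^ m * pt S.θ t x) t := by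
  have h := (S.smθ.rpow S.θ_pos (m + 1)).hasDerivAt_tInt t
  rw [← tInt_const_mul]
  convert h using 2
  ext x
  have e := ((S.smθ.hasDerivAt_pt t x).rpow_const (p := m + 1) (Or.inl (S.θ_pos t x).ne')).deriv
  rw [add_sub_cancel_right] at e
  refine Eq.trans ?_ e.symm
  ring

theorem hasDerivAt_tInt_sq {f : ℝ → ℝ → ℝ} (hf : Sm f) (t : ℝ) :
    HasDerivAt (fun s => tInt fun x => f s x ^ 2) (2 * tInt fun x => f t x * pt f t x) t := by
  have h := (hf.pow 2).hasDerivAt_tInt t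
  rw [← tInt_const_mul]
  convert h using 2
  ext x
  refine Eq.trans ?_ ((hf.hasDerivAt_pt t x).pow 2).deriv.symm
  norm_num; ring

theorem tInt_u_mul_pt_u {t : ℝ} (ht : t ∈ Icc 0 T) :
    (tInt fun x => S.u t x * pt S.u t x) = -tInt fun x => px S.u t x * S.stress t x := by
  have c1 := S.smu.continuous_x t
  have c2 := S.smu.px.continuous_x t
  have c3 := S.smu.pt.continuous_x t
  have c4 := S.sm_stress.continuous_x t
  have h := (S.smu.mul S.sm_stress).tInt_px t
  have e : px (fun t x => S.u t x * S.stress t x) t = fun x =>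
      px S.u t x * S.stress t x + S.u t x * pt S.u t x := by
    ext x
    refine ((S.smu.hasDerivAt_px t x).mul (S.sm_stress.hasDerivAt_px t x)).deriv.trans ?_
    rw [S.px_stress ht]
  rw [e, tInt_add (by fun_prop) (by fun_prop)] at h
  linarith

/-- The pressure correction `μ v_x / v - u` of the velocity. -/
def effVel (t x : ℝ) : ℝ := μ * px S.v t x / S.v t x - S.u t x

theorem sm_effVel : Sm S.effVel := (((Sm.const μ).mul S.smv.px).div S.smv S.v_pos).sub S.smu

theorem pt_effVel {t : ℝ} (ht : t ∈ Icc 0 T) (x : ℝ) : pt S.effVel t x =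
    R * px S.θ t x / S.v t x - R * S.θ t x * px S.v t x / S.v t x ^ 2 := by
  have hv := (S.v_pos t x).ne'
  have e1 : px (pt S.v) t x = px (px S.u) t x := by
    have : pt S.v t = px S.u t := funext (S.pt_v ht)
    rw [px, this]
    rfl
  refine ((((S.smv.px.hasDerivAt_pt t x).const_mul μ).div (S.smv.hasDerivAt_pt t x) hv).sub
    (S.smu.hasDerivAt_pt t x)).deriv.trans ?_
  rw [S.smv.pt_px, e1, S.pt_v ht, S.pt_u ht]
  field_simp
  ring

theorem tInt_px_u_mul {t : ℝ} :
    (tInt fun x => px S.u t x * pt (px S.u) t x) = -tInt fun x => px (px S.u) t x * pt S.u t x := by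
  have c1 := S.smu.px.continuous_x t
  have c2 := S.smu.px.px.continuous_x t
  have c3 := S.smu.pt.continuous_x t
  have c4 := S.smu.px.pt.continuous_x t
  have h := (S.smu.px.mul S.smu.pt).tInt_px t
  have e : px (fun t x => px S.u t x * pt S.u t x) t = fun x =>
      px (px S.u) t x * pt S.u t x + px S.u t x * pt (px S.u) t x := by
    ext x
    rw [S.smu.pt_px]
    exact ((S.smu.px.hasDerivAt_px t x).mul (S.smu.pt.hasDerivAt_px t x)).deriv
  rw [e, tInt_add (by fun_prop) (by fun_prop)] at h
  linarith

end Sol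

namespace Sol

variable {S : Sol μ R a b κ₁ κ₂ β γ T}

/-! ### Initial data -/

theorem Bounded.H2sq_le (hM : 1 ≤ M) (hS : S.Bounded M ε) :
    H2sq (S.v 0) + H2sq (S.u 0) + H2sq (S.θ 0) ≤ M ^ 2 :=
  Real.sqrt_le_left (by linarith) |>.1 hS.1

theorem H2sq_bounds (f : ℝ → ℝ) : 0 ≤ L2sq f ∧ 0 ≤ L2sq (deriv f) ∧
    L2sq f ≤ H2sq f ∧ L2sq (deriv f) ≤ H2sq f := by
  have h1 : 0 ≤ L2sq f := tInt_nonneg fun x _ => sq_nonneg _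
  have h2 : 0 ≤ L2sq (deriv f) := tInt_nonneg fun x _ => sq_nonneg _
  have h3 : 0 ≤ L2sq (deriv (deriv f)) := tInt_nonneg fun x _ => sq_nonneg _
  unfold H2sq
  exact ⟨h1, h2, by linarith, by linarith⟩

theorem Bounded.L2sq_le (hM : 1 ≤ M) (hS : S.Bounded M ε) :
    (L2sq (S.v 0) ≤ M ^ 2 ∧ L2sq (px S.v 0) ≤ M ^ 2) ∧
    (L2sq (S.u 0) ≤ M ^ 2 ∧ L2sq (px S.u 0) ≤ M ^ 2) ∧
    (L2sq (S.θ 0) ≤ M ^ 2 ∧ L2sq (px S.θ 0) ≤ M ^ 2) := by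
  have h := hS.H2sq_le hM
  have h1 := H2sq_bounds (S.v 0)
  have h2 := H2sq_bounds (S.u 0)
  have h3 := H2sq_bounds (S.θ 0)
  have e1 : deriv (S.v 0) = px S.v 0 := rfl
  have e2 : deriv (S.u 0) = px S.u 0 := rfl
  have e3 : deriv (S.θ 0) = px S.θ 0 := rfl
  rw [e1] at h1
  rw [e2] at h2
  rw [e3] at h3
  refine ⟨⟨?_, ?_⟩, ⟨?_, ?_⟩, ?_, ?_⟩ <;> linarith

theorem sup_le_of_L2sq {f : ℝ → ℝ → ℝ} (hf : Sm f) (t : ℝ) {N : ℝ}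
    (h1 : L2sq (f t) ≤ N) (h2 : L2sq (px f t) ≤ N) {x : ℝ} (hx : x ∈ cell) :
    f t x ≤ 2 * (1 + N) := by
  obtain ⟨y, hy, hle⟩ := exists_le_tInt (hf.continuous_x t)
  have h3 := sub_le_tInt_abs_deriv (hf.hasDerivAt_px t) (hf.px.continuous_x t) hx hy
  have h4 := tInt_abs_le (hf.px.continuous_x t)
  have h5 := tInt_abs_le (hf.continuous_x t)
  have h6 : tInt (f t) ≤ tInt fun x => |f t x| :=
    tInt_mono (hf.continuous_x t) (hf.continuous_x t).abs fun x _ => le_abs_self _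
  unfold L2sq at h1 h2
  linarith

theorem Bounded.v_le (hM : 1 ≤ M) (hS : S.Bounded M ε) {x : ℝ} (hx : x ∈ cell) :
    S.v 0 x ≤ 2 * (1 + M ^ 2) :=
  sup_le_of_L2sq S.smv 0 (hS.L2sq_le hM).1.1 (hS.L2sq_le hM).1.2 hx

theorem Bounded.θ_le (hM : 1 ≤ M) (hS : S.Bounded M ε) {x : ℝ} (hx : x ∈ cell) :
    S.θ 0 x ≤ 2 * (1 + M ^ 2) :=
  sup_le_of_L2sq S.smθ 0 (hS.L2sq_le hM).2.2.1 (hS.L2sq_le hM).2.2.2 hx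

/-! ### Conservation laws -/

variable (S) in
theorem tInt_v {t : ℝ} (ht : t ∈ Icc 0 T) : tInt (S.v t) = 1 := by
  have hz : ∀ s ∈ Icc 0 T, tInt (pt S.v s) = 0 := fun s hs => by
    rw [funext (S.pt_v hs)]; exact S.smu.tInt_px s
  have h1 := sub_le_integral (G := fun _ => 0) S.smv.hasDerivAt_tInt S.smv.pt.continuous_tInt
    continuous_const (fun s hs => (hz s hs).le) ht
  have h2 := sub_le_integral (G := fun _ => 0) (fun s => (S.smv.hasDerivAt_tInt s).neg)
    S.smv.pt.continuous_tInt.neg continuous_const (fun s hs => by simp [hz s hs]) ht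
  have := S.mean_v
  simp at h1 h2
  linarith

theorem energy_bound (P : PosParams μ R a b κ₁ κ₂ β γ T M ε) :
    ∃ Θ : ℝ, 0 < Θ ∧ ∀ S : Sol μ R a b κ₁ κ₂ β γ T, S.Bounded M ε → ∀ t ∈ Icc 0 T,
      tInt (S.θ t) ≤ Θ ∧ (tInt fun x => S.u t x ^ 2) ≤ Θ := by
  have hc := P.cv_pos
  set c := R / (γ - 1)
  set E := c * (1 + M ^ 2) + M ^ 2
  have hE : 0 < E := by positivity
  refine ⟨E / c + 2 * E, by positivity, fun S hS t ht => ?_⟩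
  obtain ⟨-, ⟨hu, -⟩, ⟨hθ, -⟩⟩ := hS.L2sq_le P.hM
  have hF : ∀ s, HasDerivAt (fun s => c * tInt (S.θ s) + 1 / 2 * tInt fun x => S.u s x ^ 2)
      (c * tInt (pt S.θ s) + 1 / 2 * (2 * tInt fun x => S.u s x * pt S.u s x)) s := fun s =>
    ((S.smθ.hasDerivAt_tInt s).const_mul c).add ((hasDerivAt_tInt_sq S.smu s).const_mul _)
  have hF' : Continuous fun s => c * tInt (pt S.θ s)
      + 1 / 2 * (2 * tInt fun x => S.u s x * pt S.u s x) := by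
    have c1 := S.smθ.pt.continuous_tInt
    have c2 := (S.smu.mul S.smu.pt).continuous_tInt
    fun_prop
  have h := sub_le_integral (G := fun _ => 0) hF hF' continuous_const (fun s hs => by
    have e1 := S.tInt_rpow_mul_pt_θ hs 0
    have e2 := S.tInt_u_mul_pt_u hs
    have e3 := S.smq.tInt_px s
    simp only [rpow_zero, one_mul, zero_mul, sub_zero] at e1
    have e4 : (tInt fun x => px S.u s x * S.stress s x) = tInt fun x =>
        μ * px S.u s x ^ 2 / S.v s x - R * S.θ s x * px S.u s x / S.v s x := by
      congr 1; ext x; unfold stress; ring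
    have e5 : c * tInt (pt S.θ s) = _ := e1
    have e6 : (tInt fun x => px S.q s x) = 0 := e3
    rw [e5, e2, e4, e6]
    linarith) ht
  simp only [intervalIntegral.integral_zero] at h
  have h1 : tInt (S.θ 0) ≤ 1 + M ^ 2 := by
    have := tInt_abs_le (S.smθ.continuous_x 0)
    have h6 : tInt (S.θ 0) ≤ tInt fun x => |S.θ 0 x| :=
      tInt_mono (S.smθ.continuous_x 0) (S.smθ.continuous_x 0).abs fun x _ => le_abs_self _
    unfold L2sq at hθ
    linarith
  have h2 : 0 ≤ tInt (S.θ t) := tInt_nonneg fun x _ => (S.θ_pos t x).le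
  have h3 : 0 ≤ tInt fun x => S.u t x ^ 2 := tInt_nonneg fun x _ => sq_nonneg _
  unfold L2sq at hu
  have h4 : c * tInt (S.θ 0) ≤ c * (1 + M ^ 2) := mul_le_mul_of_nonneg_left h1 hc.le
  have h5 : 0 ≤ c * tInt (S.θ t) := by positivity
  have hEc : 0 < E / c := by positivity
  refine ⟨?_, ?_⟩
  · have : tInt (S.θ t) ≤ E / c := by
      rw [le_div_iff₀ hc]
      have : 0 ≤ M ^ 2 := sq_nonneg M
      simp only [E]; linarith
    linarith
  · have : (tInt fun x => S.u t x ^ 2) ≤ 2 * E := by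
      have : 0 ≤ M ^ 2 := sq_nonneg M
      simp only [E]; linarith
    linarith

/-! ### Bounds for the specific volume -/

variable (S) in
/-- The accumulated pressure `(R / μ) ∫₀ᵗ θ / v ds`. -/
def accPressure (t x : ℝ) : ℝ := ∫ s in (0 : ℝ)..t, R / μ * (S.θ s x / S.v s x)

variable (S) in
theorem sm_ratio : Sm fun t x => R / μ * (S.θ t x / S.v t x) :=
  (Sm.const _).mul (S.smθ.div S.smv S.v_pos)

variable (S) in
theorem hasDerivAt_accPressure (t x : ℝ) :
    HasDerivAt (fun s => S.accPressure s x) (R / μ * (S.θ t x / S.v t x)) t :=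
  hasDerivAt_primitive (S.sm_ratio.continuous_t x) t

variable (S) in
theorem continuous_accPressure : Continuous (Function.uncurry S.accPressure) := by
  refine intervalIntegral.continuous_parametric_intervalIntegral_of_continuous (X := ℝ × ℝ)
    (f := fun p s => R / μ * (S.θ s p.2 / S.v s p.2)) (s := Prod.fst) ?_ continuous_fst
  exact S.sm_ratio.continuous.comp (continuous_snd.prodMk (continuous_snd.comp continuous_fst))

theorem accPressure_nonneg (P : PosParams μ R a b κ₁ κ₂ β γ T M ε) {t : ℝ} (ht : 0 ≤ t) (x : ℝ) :
    0 ≤ S.accPressure t x :=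
  intervalIntegral.integral_nonneg ht fun s _ => by
    have := P.hμ
    have := P.hR
    have := S.v_pos s x
    have := S.θ_pos s x
    positivity

variable (S) in
theorem log_v_identity (P : PosParams μ R a b κ₁ κ₂ β γ T M ε) {t : ℝ} (ht : t ∈ Icc 0 T) (x : ℝ) :
    μ * (log (S.v t x) - S.accPressure t x) - μ * (log (S.v t 0) - S.accPressure t 0)
      - (∫ z in (0 : ℝ)..x, S.u t z)
    = μ * log (S.v 0 x) - μ * log (S.v 0 0) - ∫ z in (0 : ℝ)..x, S.u 0 z := by
  have hμ := P.hμ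
  set H : ℝ → ℝ := fun s => μ * (log (S.v s x) - S.accPressure s x)
    - μ * (log (S.v s 0) - S.accPressure s 0) - ∫ z in (0 : ℝ)..x, S.u s z
  have hl : ∀ s y, HasDerivAt (fun s => μ * (log (S.v s y) - S.accPressure s y))
      (μ * (pt S.v s y / S.v s y - R / μ * (S.θ s y / S.v s y))) s := fun s y =>
    (((S.smv.hasDerivAt_pt s y).log (S.v_pos s y).ne').sub
      (S.hasDerivAt_accPressure s y)).const_mul μ
  have hH : ∀ s ∈ Icc 0 T, HasDerivAt H 0 s := fun s hs => by
    have h := ((hl s x).sub (hl s 0)).sub (hasDerivAt_intervalIntegral S.smu.continuous_x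
      S.smu.hasDerivAt_pt S.smu.pt.continuous 0 x s)
    refine h.congr_deriv ?_
    have e : ∫ z in (0 : ℝ)..x, pt S.u s z = S.stress s x - S.stress s 0 := by
      rw [← intervalIntegral.integral_eq_sub_of_hasDerivAt
        (fun z _ => S.sm_stress.hasDerivAt_px s z) ((S.sm_stress.px.continuous_x s).intervalIntegrable _ _)]
      congr 1; ext z; exact (S.px_stress hs z).symm
    rw [e, S.pt_v hs, S.pt_v hs]
    unfold stress
    have h1 := (S.v_pos s x).ne'
    have h2 := (S.v_pos s 0).ne'
    field_simp
    ring
  have hconst : H t = H 0 := by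
    refine constant_of_has_deriv_right_zero (a := 0) (b := T) (f := H)
      (fun s hs => (hH s hs).continuousAt.continuousWithinAt)
      (fun s hs => (hH s ⟨hs.1, hs.2.le⟩).hasDerivWithinAt) t ht
  have h0 : ∀ y, S.accPressure 0 y = 0 := fun y => intervalIntegral.integral_same
  have : H 0 = μ * log (S.v 0 x) - μ * log (S.v 0 0) - ∫ z in (0 : ℝ)..x, S.u 0 z := by
    simp only [H, h0, sub_zero]
  rw [← this, ← hconst]

theorem zero_mem_cell : (0 : ℝ) ∈ cell := by constructor <;> norm_num

theorem v_comparison (P : PosParams μ R a b κ₁ κ₂ β γ T M ε) :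
    ∃ K : ℝ, 0 < K ∧ ∀ S : Sol μ R a b κ₁ κ₂ β γ T, S.Bounded M ε → ∀ t ∈ Icc 0 T,
      ∃ B : ℝ, 0 < B ∧ ∀ x ∈ cell, B * exp (S.accPressure t x) ≤ K * S.v t x ∧
        S.v t x ≤ K * (B * exp (S.accPressure t x)) := by
  obtain ⟨Θ, hΘ, hE⟩ := energy_bound P
  have hμ := P.hμ
  set C := 2 * (1 + M ^ 2) - log ε + 2 * (1 + Θ) / μ with hC
  refine ⟨exp C, exp_pos _, fun S hS t ht => ⟨S.v t 0 * exp (-S.accPressure t 0), by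
    have := S.v_pos t 0; positivity, fun x hx => ?_⟩⟩
  have hu : ∀ s ∈ Icc 0 T, |∫ z in (0 : ℝ)..x, S.u s z| ≤ 1 + Θ := fun s hs =>
    (abs_intervalIntegral_le_tInt (S.smu.continuous_x s) zero_mem_cell hx).trans
      ((tInt_abs_le (S.smu.continuous_x s)).trans (by linarith [(hE S hS s hs).2]))
  have h1 := abs_le.1 (hu t ht)
  have h2 := abs_le.1 (hu 0 ⟨le_rfl, P.hT.le⟩)
  have hl : ∀ y ∈ cell, log ε ≤ log (S.v 0 y) ∧ log (S.v 0 y) ≤ 2 * (1 + M ^ 2) := fun y hy =>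
    ⟨log_le_log P.hε (hS.2.1 y),
      (log_le_sub_one_of_pos (S.v_pos 0 y)).trans (by linarith [hS.v_le P.hM hy])⟩
  have h3 := hl x hx
  have h4 := hl 0 zero_mem_cell
  have hid := S.log_v_identity P ht x
  set r := log (S.v t x) - S.accPressure t x - (log (S.v t 0) - S.accPressure t 0) with hr
  have hrC : |r| ≤ C := by
    have e : r = log (S.v 0 x) - log (S.v 0 0)
        + ((∫ z in (0 : ℝ)..x, S.u t z) - ∫ z in (0 : ℝ)..x, S.u 0 z) / μ := by
      field_simp
      simp only [hr]
      linarith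
    have hd : |((∫ z in (0 : ℝ)..x, S.u t z) - ∫ z in (0 : ℝ)..x, S.u 0 z) / μ|
        ≤ 2 * (1 + Θ) / μ := by
      rw [abs_div, abs_of_pos hμ]
      gcongr
      rw [abs_le]; constructor <;> linarith
    rw [abs_le] at hd ⊢
    rw [e]
    constructor <;> linarith
  have hv : S.v t x = S.v t 0 * exp (-S.accPressure t 0) * exp (S.accPressure t x) * exp r := by
    rw [← exp_log (S.v_pos t x), ← exp_log (S.v_pos t 0), ← exp_add, ← exp_add, ← exp_add]
    congr 1; simp only [hr]; ring
  rw [abs_le] at hrC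
  have hv0 := S.v_pos t 0
  set Q := S.v t 0 * exp (-S.accPressure t 0) * exp (S.accPressure t x)
  have hQ : 0 < Q := by positivity
  rw [hv]
  refine ⟨?_, ?_⟩
  · have : 1 ≤ exp C * exp r := by rw [← exp_add]; exact one_le_exp (by linarith)
    nlinarith
  · have : exp r ≤ exp C := exp_le_exp.2 hrC.2
    nlinarith

theorem v_bounds_aux (P : PosParams μ R a b κ₁ κ₂ β γ T M ε) :
    ∃ c C : ℝ, 0 < c ∧ 0 < C ∧ ∀ S : Sol μ R a b κ₁ κ₂ β γ T, S.Bounded M ε → ∀ t ∈ Icc 0 T,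
      ∀ x ∈ cell, c ≤ S.v t x ∧ S.v t x ≤ C * (1 + ∫ s in (0 : ℝ)..t, S.θ s x) := by
  obtain ⟨Θ, hΘ, hE⟩ := energy_bound P
  obtain ⟨K, hK, hcomp⟩ := v_comparison P
  have hμ := P.hμ
  have hR := P.hR
  have hT := P.hT
  set L := R / μ * (K ^ 2 * Θ) with hL
  have hLpos : 0 < L := by positivity
  set N₁ := exp (L * T) with hN₁
  have hN₁p : 0 < N₁ := exp_pos _
  refine ⟨1 / (K ^ 2 * N₁), K ^ 2 * (1 + R / μ * (K ^ 2 * N₁)), by positivity, by positivity,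
    fun S hS => ?_⟩
  have hcA := S.continuous_accPressure
  have cA : ∀ t, Continuous (S.accPressure t) := fun t => hcA.comp (Continuous.prodMk_right t)
  have hone : ∀ t, 0 ≤ t → ∀ x, 1 ≤ exp (S.accPressure t x) := fun t ht x =>
    one_le_exp (accPressure_nonneg P ht x)
  have hd : ∀ t x, HasDerivAt (fun s => exp (S.accPressure s x))
      (exp (S.accPressure t x) * (R / μ * (S.θ t x / S.v t x))) t := fun t x =>
    (S.hasDerivAt_accPressure t x).exp
  have hc' : Continuous (Function.uncurry fun t x =>
      exp (S.accPressure t x) * (R / μ * (S.θ t x / S.v t x))) :=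
    hcA.rexp.mul S.sm_ratio.continuous
  set N : ℝ → ℝ := fun t => tInt fun x => exp (S.accPressure t x) with hN
  have hN' : ∀ t, HasDerivAt N
      (tInt fun x => exp (S.accPressure t x) * (R / μ * (S.θ t x / S.v t x))) t :=
    hasDerivAt_intervalIntegral (fun t => (cA t).rexp) hd hc' (-(1 / 2)) (1 / 2)
  -- the weight and the mass constraint
  have hinv : ∀ t ∈ Icc 0 T, ∃ B, 0 < B ∧ 1 ≤ K * (B * N t) ∧ B ≤ K ∧
      ∀ x ∈ cell, B * exp (S.accPressure t x) ≤ K * S.v t x ∧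
        S.v t x ≤ K * (B * exp (S.accPressure t x)) := fun t ht => by
    obtain ⟨B, hB, hx⟩ := hcomp S hS t ht
    have hm := S.tInt_v ht
    have cv := S.smv.continuous_x t
    have cAt := cA t
    refine ⟨B, hB, ?_, ?_, hx⟩
    · rw [← hm, hN, ← tInt_const_mul, ← tInt_const_mul]
      exact tInt_mono cv (by fun_prop) fun x h => (hx x h).2
    · have : (tInt fun _ => B) ≤ tInt fun x => K * S.v t x :=
        tInt_mono continuous_const (by fun_prop) fun x h =>
          (le_mul_of_one_le_right hB.le (hone t ht.1 x)).trans (hx x h).1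
      rw [tInt_const, tInt_const_mul] at this
      have e : (tInt fun x => S.v t x) = 1 := hm
      rw [e] at this
      linarith
  have hpt : ∀ t ∈ Icc 0 T, ∀ x ∈ cell, exp (S.accPressure t x) * (R / μ * (S.θ t x / S.v t x))
      ≤ R / μ * (K ^ 2 * N t) * S.θ t x := fun t ht x hx => by
    obtain ⟨B, hB, h1, -, h2⟩ := hinv t ht
    have hv := S.v_pos t x
    have hθ := S.θ_pos t x
    have h3 := (h2 x hx).1
    have h4 : exp (S.accPressure t x) ≤ K ^ 2 * N t * S.v t x := by
      have : exp (S.accPressure t x) * B ≤ K ^ 2 * N t * S.v t x * B := by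
        calc exp (S.accPressure t x) * B ≤ K * S.v t x * 1 := by linarith
          _ ≤ K * S.v t x * (K * (B * N t)) := by gcongr
          _ = _ := by ring
      exact le_of_mul_le_mul_right this hB
    calc exp (S.accPressure t x) * (R / μ * (S.θ t x / S.v t x))
        ≤ K ^ 2 * N t * S.v t x * (R / μ * (S.θ t x / S.v t x)) := by gcongr
      _ = _ := by field_simp
  have hN1 : ∀ t, 0 ≤ t → 1 ≤ N t := fun t ht => by
    rw [← tInt_const 1]
    have cAt := cA t
    exact tInt_mono continuous_const (by fun_prop) fun x _ => hone t ht x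
  have hNpos : ∀ t, 0 < N t := fun t => by
    have cAt := cA t
    obtain ⟨y, -, hy⟩ := exists_le_tInt (f := fun x => exp (S.accPressure t x)) (by fun_prop)
    exact (exp_pos _).trans_le hy
  have hNle : ∀ t ∈ Icc 0 T, N t ≤ N₁ := fun t ht => by
    have h := sub_le_integral (G := fun _ => L) (T := T) (fun s => (hN' s).log (hNpos s).ne') (by
        refine Continuous.div (continuous_tInt hc') (continuous_tInt hcA.rexp) fun s => (hNpos s).ne')
      continuous_const (fun s hs => by
        rw [div_le_iff₀ (hNpos s)]
        have c1 := hc'.comp (Continuous.prodMk_right s)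
        have c2 := S.smθ.continuous_x s
        refine (tInt_mono c1 (by fun_prop) (hpt s hs)).trans ?_
        rw [tInt_const_mul]
        have h1 : tInt (S.θ s) ≤ Θ := (hE S hS s hs).1
        have h2 := hNpos s
        calc R / μ * (K ^ 2 * N s) * tInt (S.θ s) ≤ R / μ * (K ^ 2 * N s) * Θ := by gcongr
          _ = L * N s := by rw [hL]; ring) ht
    have h0 : N 0 = 1 := by
      have : ∀ y, S.accPressure 0 y = 0 := fun y => intervalIntegral.integral_same
      simp only [hN, this, exp_zero]
      exact tInt_const 1
    rw [h0, log_one, sub_zero, intervalIntegral.integral_const, sub_zero, smul_eq_mul] at h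
    have h' : log (N t) ≤ L * T := by
      refine h.trans ?_
      nlinarith [ht.2]
    rw [hN₁]
    exact (log_le_iff_le_exp (hNpos t)).1 h'
  intro t ht x hx
  obtain ⟨B, hB, h1, h2, h3⟩ := hinv t ht
  have hA := hone t ht.1 x
  obtain ⟨h4, h5⟩ := h3 x hx
  refine ⟨?_, ?_⟩
  · rw [div_le_iff₀ (by positivity)]
    calc 1 ≤ K * (B * N t) := h1
      _ ≤ K * (B * N₁) := by gcongr; exact hNle t ht
      _ = K * N₁ * B := by ring
      _ ≤ K * N₁ * (K * S.v t x) := by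
        gcongr
        exact (le_mul_of_one_le_right hB.le hA).trans h4
      _ = _ := by ring
  · have h6 := sub_le_integral (G := fun s => R / μ * (K ^ 2 * N₁) * S.θ s x) (T := T)
      (fun s => hd s x) (hc'.comp (Continuous.prodMk_left x))
      ((S.smθ.continuous_t x).const_mul _) (fun s hs => (hpt s hs x hx).trans (by
        have := S.θ_pos s x
        have := hNle s hs
        gcongr)) ht
    have : S.accPressure 0 x = 0 := intervalIntegral.integral_same
    rw [this, exp_zero, intervalIntegral.integral_const_mul] at h6
    have hI : 0 ≤ ∫ s in (0 : ℝ)..t, S.θ s x :=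
      intervalIntegral.integral_nonneg ht.1 fun s _ => (S.θ_pos s x).le
    set I := ∫ s in (0 : ℝ)..t, S.θ s x
    have hm : 0 < R / μ * (K ^ 2 * N₁) := by positivity
    set m := R / μ * (K ^ 2 * N₁)
    calc S.v t x ≤ K * (B * exp (S.accPressure t x)) := h5
      _ ≤ K * (K * (1 + m * I)) := by gcongr; linarith
      _ ≤ K ^ 2 * (1 + m) * (1 + I) := by
        have : 1 + m * I ≤ (1 + m) * (1 + I) := by nlinarith
        calc K * (K * (1 + m * I)) = K ^ 2 * (1 + m * I) := by ring
          _ ≤ K ^ 2 * ((1 + m) * (1 + I)) := by gcongr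
          _ = _ := by ring

/-! ### The entropy-type dissipation -/

variable (S) in
/-- The dissipation obtained by testing the temperature equation with `θ ^ (-δ)`. -/
def entropyDissip (δ t : ℝ) : ℝ :=
  tInt fun x => S.θ t x ^ (-δ - 1) * px S.θ t x * S.flux t x

variable (S) in
theorem sm_entropyDissip (δ : ℝ) :
    Sm fun t x => S.θ t x ^ (-δ - 1) * px S.θ t x * S.flux t x :=
  ((S.smθ.rpow S.θ_pos _).mul S.smθ.px).mul S.sm_flux

variable (S) in
theorem continuous_entropyDissip (δ : ℝ) : Continuous (S.entropyDissip δ) :=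
  (S.sm_entropyDissip δ).continuous_tInt

theorem entropyDissip_nonneg (P : PosParams μ R a b κ₁ κ₂ β γ T M ε) (δ t : ℝ) :
    0 ≤ S.entropyDissip δ t :=
  tInt_nonneg fun x _ => by
    have h1 := rpow_pos_of_pos (S.θ_pos t x) (-δ - 1)
    have h2 := S.v_pos t x
    have h3 := S.cond_nonneg P t x
    have : S.θ t x ^ (-δ - 1) * px S.θ t x * S.flux t x
        = S.θ t x ^ (-δ - 1) * (S.cond t x / S.v t x) * px S.θ t x ^ 2 := by
      unfold flux; ring
    rw [this]
    positivity

variable (S) in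
theorem cond_div_v (t x : ℝ) :
    S.cond t x / S.v t x = κ₁ / S.v t x + κ₂ * S.θ t x ^ β := by
  have h2 := (S.v_pos t x).ne'
  unfold cond kappa
  field_simp

theorem tInt_grad_le_entropyDissip (P : PosParams μ R a b κ₁ κ₂ β γ T M ε) (δ t : ℝ) :
    κ₂ * (tInt fun x => (S.θ t x ^ ((β - 1 - δ) / 2) * |px S.θ t x|) ^ 2)
      ≤ S.entropyDissip δ t := by
  have c1 := (S.smθ.rpow S.θ_pos ((β - 1 - δ) / 2)).continuous_x t
  have c2 := S.smθ.px.continuous_x t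
  rw [← tInt_const_mul]
  refine tInt_mono (((c1.mul c2.abs).pow 2).const_mul _)
    ((S.sm_entropyDissip δ).continuous_x t) fun x _ => ?_
  have hθ := S.θ_pos t x
  have e : (S.θ t x ^ ((β - 1 - δ) / 2)) ^ 2 = S.θ t x ^ (-δ - 1) * S.θ t x ^ β := by
    rw [← rpow_natCast, ← rpow_mul hθ.le, ← rpow_add hθ]
    congr 1; push_cast; ring
  have h1 := rpow_pos_of_pos hθ (-δ - 1)
  have h2 : κ₂ * S.θ t x ^ β ≤ S.cond t x / S.v t x := by
    rw [cond_div_v]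
    have := div_pos P.hκ₁ (S.v_pos t x)
    linarith
  rw [mul_pow, e, sq_abs]
  calc κ₂ * (S.θ t x ^ (-δ - 1) * S.θ t x ^ β * px S.θ t x ^ 2)
      = S.θ t x ^ (-δ - 1) * (κ₂ * S.θ t x ^ β) * px S.θ t x ^ 2 := by ring
    _ ≤ S.θ t x ^ (-δ - 1) * (S.cond t x / S.v t x) * px S.θ t x ^ 2 := by gcongr
    _ = _ := by unfold flux; ring

theorem θ_sq_le (P : PosParams μ R a b κ₁ κ₂ β γ T M ε) {δ : ℝ} (hδ : δ ≤ β) :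
    ∃ C : ℝ, 0 < C ∧ ∀ S : Sol μ R a b κ₁ κ₂ β γ T, S.Bounded M ε → ∀ t ∈ Icc 0 T,
      ∀ x ∈ cell, S.θ t x ^ 2 ≤ C * (1 + S.entropyDissip δ t) := by
  obtain ⟨Θ, hΘ, hE⟩ := energy_bound P
  have hκ₂ := P.hκ₂
  set p := (β + 2 - δ) / 2 with hp
  have hp1 : 1 ≤ p := by linarith
  refine ⟨1 + 2 * (Θ ^ p) ^ 2 + 2 * p ^ 2 * (Θ / κ₂), by positivity, fun S hS t ht x hx => ?_⟩
  have hQ := S.entropyDissip_nonneg P δ t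
  have c0 := S.smθ.continuous_x t
  have c1 := (S.smθ.rpow S.θ_pos ((β - 1 - δ) / 2)).continuous_x t
  have c2 := S.smθ.px.continuous_x t
  have c3 := (S.smθ.rpow S.θ_pos (p - 1)).continuous_x t
  have c4 := (S.smθ.rpow S.θ_pos (1 / 2)).continuous_x t
  obtain ⟨y, hy, hyΘ⟩ := exists_le_tInt c0
  have hyp : S.θ t y ^ p ≤ Θ ^ p :=
    rpow_le_rpow (S.θ_pos t y).le (hyΘ.trans (hE S hS t ht).1) (by linarith)
  have hd : ∀ z, HasDerivAt (fun z => S.θ t z ^ p) (px S.θ t z * p * S.θ t z ^ (p - 1)) z :=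
    fun z => (S.smθ.hasDerivAt_px t z).rpow_const (Or.inl (S.θ_pos t z).ne')
  have h1 := sub_le_tInt_abs_deriv hd ((c2.mul continuous_const).mul c3) hx hy
  have e1 : (fun z => |px S.θ t z * p * S.θ t z ^ (p - 1)|) = fun z =>
      p * (S.θ t z ^ (1 / 2 : ℝ) * (S.θ t z ^ ((β - 1 - δ) / 2) * |px S.θ t z|)) := by
    ext z
    have hz := S.θ_pos t z
    have : S.θ t z ^ (p - 1) = S.θ t z ^ (1 / 2 : ℝ) * S.θ t z ^ ((β - 1 - δ) / 2) := by
      rw [← rpow_add hz]; congr 1; rw [hp]; ring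
    rw [abs_mul, abs_mul, abs_of_pos (show 0 < p by linarith), abs_of_pos (rpow_pos_of_pos hz _),
      this]
    ring
  rw [e1, tInt_const_mul] at h1
  have h2 := tInt_sq_le c4 (c1.mul c2.abs)
  set W := tInt fun z => S.θ t z ^ (1 / 2 : ℝ) * (S.θ t z ^ ((β - 1 - δ) / 2) * |px S.θ t z|)
  have e2 : (tInt fun x => (S.θ t x ^ (1 / 2 : ℝ)) ^ 2) = tInt (S.θ t) := by
    congr 1; ext z
    rw [← rpow_natCast, ← rpow_mul (S.θ_pos t z).le]
    norm_num
  rw [e2] at h2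
  have h3 := S.tInt_grad_le_entropyDissip P δ t
  set V := tInt fun x => (S.θ t x ^ ((β - 1 - δ) / 2) * |px S.θ t x|) ^ 2
  have hV : 0 ≤ V := tInt_nonneg fun _ _ => sq_nonneg _
  have h4 : W ^ 2 ≤ Θ / κ₂ * S.entropyDissip δ t := by
    have : V ≤ S.entropyDissip δ t / κ₂ := by rw [le_div_iff₀ hκ₂]; linarith
    calc W ^ 2 ≤ tInt (S.θ t) * V := h2
      _ ≤ Θ * (S.entropyDissip δ t / κ₂) := by
        gcongr
        exact (hE S hS t ht).1
      _ = _ := by ring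
  have h5 : S.θ t x ^ p ≤ Θ ^ p + p * W := by linarith
  have hx0 := S.θ_pos t x
  have h6 : (S.θ t x ^ p) ^ 2 ≤ 2 * (Θ ^ p) ^ 2 + 2 * p ^ 2 * W ^ 2 := by
    have := rpow_pos_of_pos hx0 p
    nlinarith [sq_nonneg (Θ ^ p - p * W)]
  have h7 : S.θ t x ^ 2 ≤ 1 + (S.θ t x ^ p) ^ 2 := by
    rcases le_total (S.θ t x) 1 with h | h
    · nlinarith [sq_nonneg (S.θ t x ^ p)]
    · have : S.θ t x ≤ S.θ t x ^ p := by
        simpa using rpow_le_rpow_of_exponent_le h hp1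
      nlinarith
  have h8 : 2 * p ^ 2 * W ^ 2 ≤ 2 * p ^ 2 * (Θ / κ₂ * S.entropyDissip δ t) := by gcongr
  have h9 : 0 ≤ 2 * (Θ ^ p) ^ 2 * S.entropyDissip δ t := by positivity
  have h10 : 0 ≤ 2 * p ^ 2 * (Θ / κ₂) := by positivity
  nlinarith

theorem rpow_le_one_add {x p : ℝ} (hx : 0 < x) (h0 : 0 ≤ p) (h1 : p ≤ 1) : x ^ p ≤ 1 + x := by
  rcases le_total x 1 with h | h
  · exact (rpow_le_one hx.le h h0).trans (by linarith)
  · have := rpow_le_rpow_of_exponent_le h h1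
    rw [rpow_one] at this
    linarith

/-- Young's inequality for the pressure work. -/
theorem viscous_sub_pressure_ge (P : PosParams μ R a b κ₁ κ₂ β γ T M ε) {v θ c : ℝ} (z : ℝ)
    (hc : 0 < c) (hv : c ≤ v) :
    -(R ^ 2 / (4 * μ * c) * θ ^ 2) ≤ μ * z ^ 2 / v - R * θ * z / v := by
  have hμ := P.hμ
  have hv0 : 0 < v := hc.trans_le hv
  have h1 : μ * z ^ 2 / v - R * θ * z / v
      = (2 * μ * z - R * θ) ^ 2 / (4 * μ * v) - R ^ 2 * θ ^ 2 / (4 * μ * v) := by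
    field_simp; ring
  have h2 : 0 ≤ (2 * μ * z - R * θ) ^ 2 / (4 * μ * v) := by positivity
  have h3 : R ^ 2 * θ ^ 2 / (4 * μ * v) ≤ R ^ 2 * θ ^ 2 / (4 * μ * c) := by gcongr
  have h4 : R ^ 2 / (4 * μ * c) * θ ^ 2 = R ^ 2 * θ ^ 2 / (4 * μ * c) := by ring
  linarith

theorem integral_entropyDissip_le (P : PosParams μ R a b κ₁ κ₂ β γ T M ε) {δ : ℝ} (hδ0 : 0 < δ)
    (hδ : δ ≤ β) (hδ1 : δ ≤ 1 / 2) :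
    ∃ C : ℝ, 0 < C ∧ ∀ S : Sol μ R a b κ₁ κ₂ β γ T, S.Bounded M ε → ∀ t ∈ Icc 0 T,
      ∫ s in (0 : ℝ)..t, S.entropyDissip δ s ≤ C := by
  obtain ⟨Θ, hΘ, hE⟩ := energy_bound P
  obtain ⟨c, _, hc, _, hv⟩ := v_bounds_aux P
  obtain ⟨C₂, hC₂, hsup⟩ := θ_sq_le P hδ
  have hμ := P.hμ
  have hR := P.hR
  have hT := P.hT
  have hcv := P.cv_pos
  set k := R / (γ - 1)
  set r := R ^ 2 / (4 * μ * c) with hr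
  have hrp : 0 < r := by positivity
  set η := δ / (2 * (r * Θ) * C₂) with hη
  have hηp : 0 < η := by positivity
  set L := r * Θ * (1 + 1 / (4 * η)) + δ / 2 with hL
  have hLp : 0 < L := by positivity
  refine ⟨2 / δ * (k / (1 - δ) * (1 + Θ) + L * T), by
    have : 0 < 1 - δ := by linarith
    positivity, fun S hS t ht => ?_⟩
  have h1δ : 0 < 1 - δ := by linarith
  have key : ∀ s ∈ Icc 0 T, -(k * tInt fun x => S.θ s x ^ (-δ) * pt S.θ s x)
      + δ / 2 * S.entropyDissip δ s ≤ L := fun s hs => by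
    have hQ := S.entropyDissip_nonneg P δ s
    have e1 := S.tInt_rpow_mul_pt_θ hs (-δ)
    have e2 := S.tInt_rpow_mul_px_q P hs (-δ)
    have e3 : (tInt fun x => S.θ s x ^ (-δ - 1) * px S.θ s x * S.flux s x)
      = S.entropyDissip δ s := rfl
    rw [e3] at e1
    have e4 : (tInt fun x => S.θ s x ^ (-δ) * px S.q s x) ≤ 0 := by
      by_contra! h
      nlinarith
    set w := 1 + 1 / (4 * η) + η * (C₂ * (1 + S.entropyDissip δ s)) with hw
    have e5 : -(r * w) * tInt (S.θ s) ≤ (tInt fun x => S.θ s x ^ (-δ) * (μ * px S.u s x ^ 2 / S.v s x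
        - R * S.θ s x * px S.u s x / S.v s x)) := by
      rw [← tInt_const_mul]
      have sm : Sm fun t x => S.θ t x ^ (-δ) * (μ * px S.u t x ^ 2 / S.v t x
        - R * S.θ t x * px S.u t x / S.v t x) :=
        (S.smθ.rpow S.θ_pos _).mul
          ((((Sm.const μ).mul (S.smu.px.pow 2)).div S.smv S.v_pos).sub
            ((((Sm.const R).mul S.smθ).mul S.smu.px).div S.smv S.v_pos))
      refine tInt_mono ((S.smθ.continuous_x s).const_mul _) (sm.continuous_x s) fun x hx => ?_
      have hθ := S.θ_pos s x
      have i1 := viscous_sub_pressure_ge (θ := S.θ s x) P (px S.u s x) hc (hv S hS s hs x hx).1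
      have i2 : S.θ s x ^ (-δ) * S.θ s x ^ 2 = S.θ s x * S.θ s x ^ (1 - δ) := by
        have : S.θ s x ^ (1 - δ) = S.θ s x ^ (-δ) * S.θ s x := by
          rw [show 1 - δ = -δ + 1 by ring, rpow_add hθ, rpow_one]
        rw [this]; ring
      have i3 : S.θ s x ^ (1 - δ) ≤ w := by
        refine (rpow_le_one_add hθ h1δ.le (by linarith)).trans ?_
        have := hsup S hS s hs x hx
        have i4 : S.θ s x ≤ 1 / (4 * η) + η * S.θ s x ^ 2 := by
          have : 1 / (4 * η) + η * S.θ s x ^ 2 - S.θ s x = (2 * η * S.θ s x - 1) ^ 2 / (4 * η) := by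
            field_simp; ring
          have : 0 ≤ (2 * η * S.θ s x - 1) ^ 2 / (4 * η) := by positivity
          linarith
        have i5 : η * S.θ s x ^ 2 ≤ η * (C₂ * (1 + S.entropyDissip δ s)) := by gcongr
        rw [hw]
        linarith
      calc -(r * w) * S.θ s x ≤ -(r * (S.θ s x * S.θ s x ^ (1 - δ))) := by
            have : r * S.θ s x * S.θ s x ^ (1 - δ) ≤ r * S.θ s x * w := by gcongr
            linarith
        _ = S.θ s x ^ (-δ) * -(r * S.θ s x ^ 2) := by rw [← i2]; ring
        _ ≤ _ := by gcongr
    have e6 : r * w * tInt (S.θ s) ≤ r * w * Θ := by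
      gcongr
      exact (hE S hS s hs).1
    have e7 : r * w * Θ = L + δ / 2 * S.entropyDissip δ s := by
      have : r * Θ * (η * C₂) = δ / 2 := by rw [hη]; field_simp
      calc r * w * Θ = r * Θ * (1 + 1 / (4 * η)) + r * Θ * (η * C₂) * (1 + S.entropyDissip δ s) := by
            rw [hw]; ring
        _ = _ := by rw [this, hL]; ring
    linarith
  have hF := fun s => (S.hasDerivAt_tInt_rpow (-δ) s).const_mul (-(k / (1 - δ)))
  have hF' : Continuous fun s => -(k / (1 - δ)) *
      ((-δ + 1) * tInt fun x => S.θ s x ^ (-δ) * pt S.θ s x) :=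
    (((S.smθ.rpow S.θ_pos _).mul S.smθ.pt).continuous_tInt.const_mul _).const_mul _
  have h := add_integral_le hF hF' ((S.continuous_entropyDissip δ).const_mul (δ / 2))
    (continuous_const (y := L)) (fun s hs => by
      refine le_trans (le_of_eq ?_) (key s hs)
      congr 1
      field_simp
      ring) ht
  rw [intervalIntegral.integral_const_mul, intervalIntegral.integral_const, smul_eq_mul,
    sub_zero] at h
  have hFb : (tInt fun x => S.θ t x ^ (-δ + 1)) ≤ 1 + Θ := by
    have c0 := S.smθ.continuous_x t
    have c1 := (S.smθ.rpow S.θ_pos (-δ + 1)).continuous_x t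
    have : (tInt fun x => S.θ t x ^ (-δ + 1)) ≤ tInt fun x => 1 + S.θ t x :=
      tInt_mono c1 (by fun_prop) fun x _ => rpow_le_one_add (S.θ_pos t x) (by linarith) (by linarith)
    rw [tInt_add continuous_const c0, tInt_const] at this
    have h2 : (tInt fun x => S.θ t x) ≤ Θ := (hE S hS t ht).1
    linarith
  have hF0 : 0 ≤ tInt fun x => S.θ 0 x ^ (-δ + 1) :=
    tInt_nonneg fun x _ => (rpow_pos_of_pos (S.θ_pos 0 x) _).le
  have hkp : 0 < k / (1 - δ) := by positivity
  have h3 : k / (1 - δ) * (tInt fun x => S.θ t x ^ (-δ + 1)) ≤ k / (1 - δ) * (1 + Θ) := by gcongr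
  have h4 : 0 ≤ k / (1 - δ) * tInt fun x => S.θ 0 x ^ (-δ + 1) := by positivity
  have h5 : t * L ≤ L * T := by nlinarith [ht.2]
  have h6 : δ / 2 * (∫ s in (0 : ℝ)..t, S.entropyDissip δ s) ≤ k / (1 - δ) * (1 + Θ) + L * T := by
    linarith
  calc (∫ s in (0 : ℝ)..t, S.entropyDissip δ s)
      = 2 / δ * (δ / 2 * (∫ s in (0 : ℝ)..t, S.entropyDissip δ s)) := by field_simp
    _ ≤ _ := by gcongr

theorem v_bounds (P : PosParams μ R a b κ₁ κ₂ β γ T M ε) :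
    ∃ c C : ℝ, 0 < c ∧ 0 < C ∧ ∀ S : Sol μ R a b κ₁ κ₂ β γ T, S.Bounded M ε → ∀ t ∈ Icc 0 T,
      ∀ x ∈ cell, c ≤ S.v t x ∧ S.v t x ≤ C := by
  obtain ⟨c, C, hc, hC, hv⟩ := v_bounds_aux P
  have hβ := P.hβ
  have hT := P.hT
  obtain ⟨C₂, hC₂, hsup⟩ := θ_sq_le P (min_le_left β (1 / 2))
  obtain ⟨C₃, hC₃, hint⟩ := integral_entropyDissip_le P (lt_min hβ (by norm_num : (0 : ℝ) < 1 / 2))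
    (min_le_left _ _) (min_le_right _ _)
  set δ := min β (1 / 2)
  refine ⟨c, C * (1 + (1 + C₂) * (T + C₃)), hc, by positivity, fun S hS t ht x hx =>
    ⟨(hv S hS t ht x hx).1, (hv S hS t ht x hx).2.trans ?_⟩⟩
  have c1 := S.continuous_entropyDissip δ
  have h1 : ∫ s in (0 : ℝ)..t, S.θ s x
      ≤ ∫ s in (0 : ℝ)..t, (1 + C₂) * (1 + S.entropyDissip δ s) := by
    refine intervalIntegral.integral_mono_on ht.1 ((S.smθ.continuous_t x).intervalIntegrable _ _)
      (Continuous.intervalIntegrable (by fun_prop) _ _) fun s hs => ?_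
    have := hsup S hS s ⟨hs.1, hs.2.trans ht.2⟩ x hx
    have hQ := S.entropyDissip_nonneg P δ s
    nlinarith [sq_nonneg (S.θ s x - 1)]
  rw [integral_const_mul_one_add c1] at h1
  have h2 := hint S hS t ht
  have h3 : (1 + C₂) * (t + ∫ s in (0 : ℝ)..t, S.entropyDissip δ s) ≤ (1 + C₂) * (T + C₃) := by
    gcongr
    exact ht.2
  gcongr
  linarith

/-- The collected bounds driving the higher order estimates: a time-integrable
quantity controls the temperature in `L^∞` and its weighted gradient. -/
theorem exists_control (P : PosParams μ R a b κ₁ κ₂ β γ T M ε) :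
    ∃ C : ℝ, 0 < C ∧ ∀ S : Sol μ R a b κ₁ κ₂ β γ T, S.Bounded M ε →
      ∃ Q : ℝ → ℝ, Continuous Q ∧ (∀ t, 0 ≤ Q t) ∧ ∀ t ∈ Icc 0 T,
        ∫ s in (0 : ℝ)..t, Q s ≤ C ∧ (∀ x ∈ cell, S.θ t x ^ 2 ≤ C * (1 + Q t)) ∧
        (tInt fun x => px S.θ t x ^ 2 / S.θ t x) ≤ C * Q t := by
  obtain ⟨c, C, hc, hC, hv⟩ := v_bounds P
  have hβ := P.hβ
  have hκ₁ := P.hκ₁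
  have hκ₂ := P.hκ₂
  obtain ⟨C₂, hC₂, hsup⟩ := θ_sq_le P (min_le_left β (1 / 2))
  obtain ⟨C₃, hC₃, hint⟩ := integral_entropyDissip_le P (lt_min hβ (by norm_num : (0 : ℝ) < 1 / 2))
    (min_le_left _ _) (min_le_right _ _)
  have hδβ := min_le_left β (1 / 2)
  have hδ0 : 0 < min β (1 / 2) := lt_min hβ (by norm_num)
  set δ := min β (1 / 2)
  set C₄ := C / κ₁ + 1 / κ₂ with hC₄
  have hC₄p : 0 < C₄ := by positivity
  refine ⟨C₂ + C₃ + C₄, by positivity, fun S hS => ⟨S.entropyDissip δ,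
    S.continuous_entropyDissip δ, S.entropyDissip_nonneg P δ, fun t ht => ⟨?_, ?_, ?_⟩⟩⟩
  · linarith [hint S hS t ht]
  · intro x hx
    refine (hsup S hS t ht x hx).trans ?_
    have hQ := S.entropyDissip_nonneg P δ t
    gcongr
    linarith
  · have hQ := S.entropyDissip_nonneg P δ t
    have : (tInt fun x => px S.θ t x ^ 2 / S.θ t x) ≤ C₄ * S.entropyDissip δ t := by
      unfold entropyDissip
      rw [← tInt_const_mul]
      refine tInt_mono (((S.smθ.px.pow 2).div S.smθ S.θ_pos).continuous_x t)
        (((S.sm_entropyDissip δ).continuous_x t).const_mul _) fun x hx => ?_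
      have hθ := S.θ_pos t x
      have hv0 := S.v_pos t x
      have hvC := (hv S hS t ht x hx).2
      have h1 : S.θ t x ^ δ ≤ C₄ * (S.cond t x / S.v t x) := by
        have hb := rpow_pos_of_pos hθ β
        have h2 : 1 + S.θ t x ^ β ≤ C₄ * (S.cond t x / S.v t x) := by
          rw [cond_div_v]
          have i1 : 1 / C ≤ 1 / S.v t x := by gcongr
          have i2 : 1 ≤ C / κ₁ * (κ₁ / S.v t x) := by
            have : C / κ₁ * (κ₁ / S.v t x) = C / S.v t x := by field_simp
            rw [this, le_div_iff₀ hv0]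
            linarith
          have i3 : 1 / κ₂ * (κ₂ * S.θ t x ^ β) = S.θ t x ^ β := by field_simp
          have i4 : 0 ≤ C / κ₁ * (κ₂ * S.θ t x ^ β) := by positivity
          have i5 : 0 ≤ 1 / κ₂ * (κ₁ / S.v t x) := by positivity
          rw [hC₄]
          nlinarith
        refine le_trans ?_ h2
        rcases le_total (S.θ t x) 1 with h | h
        · have := rpow_le_one hθ.le h hδ0.le
          linarith
        · have := rpow_le_rpow_of_exponent_le h hδβ
          linarith
      have h3 := rpow_pos_of_pos hθ (-δ - 1)
      have h4 : S.θ t x ^ δ * S.θ t x ^ (-δ - 1) = 1 / S.θ t x := by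
        rw [← rpow_add hθ, show δ + (-δ - 1) = -1 by ring, rpow_neg_one, one_div]
      calc px S.θ t x ^ 2 / S.θ t x = S.θ t x ^ δ * S.θ t x ^ (-δ - 1) * px S.θ t x ^ 2 := by
            rw [h4]; ring
        _ ≤ C₄ * (S.cond t x / S.v t x) * S.θ t x ^ (-δ - 1) * px S.θ t x ^ 2 := by gcongr
        _ = _ := by unfold flux; ring
    refine this.trans ?_
    gcongr
    linarith

/-! ### Dissipation of the velocity -/

theorem integral_dissip_le (P : PosParams μ R a b κ₁ κ₂ β γ T M ε) :
    ∃ C : ℝ, 0 < C ∧ ∀ S : Sol μ R a b κ₁ κ₂ β γ T, S.Bounded M ε → ∀ t ∈ Icc 0 T,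
      ∫ s in (0 : ℝ)..t, (tInt fun x => px S.u s x ^ 2 / S.v s x) ≤ C := by
  obtain ⟨c, _, hc, _, hv⟩ := v_bounds P
  obtain ⟨C₁, hC₁, hctrl⟩ := exists_control P
  have hμ := P.hμ
  have hR := P.hR
  have hT := P.hT
  set r := R ^ 2 / (2 * μ * c) with hr
  have hrp : 0 < r := by positivity
  refine ⟨2 / μ * (1 / 2 * M ^ 2 + r * C₁ * (T + C₁)), by positivity, fun S hS t ht => ?_⟩
  obtain ⟨Q, cQ, hQ, hQC⟩ := hctrl S hS
  obtain ⟨-, ⟨hu, -⟩, -⟩ := hS.L2sq_le P.hM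
  have hF := fun s => (hasDerivAt_tInt_sq S.smu s).const_mul (1 / 2)
  have hF' : Continuous fun s => 1 / 2 * (2 * tInt fun x => S.u s x * pt S.u s x) :=
    ((S.smu.mul S.smu.pt).continuous_tInt.const_mul _).const_mul _
  have h := add_integral_le (G := fun s => r * C₁ * (1 + Q s)) hF hF'
    (S.sm_dissip.continuous_tInt.const_mul (μ / 2)) (by fun_prop) (fun s hs => by
      rw [S.tInt_u_mul_pt_u hs, ← tInt_const_mul]
      have : (tInt fun x => μ / 2 * (px S.u s x ^ 2 / S.v s x) - r * (C₁ * (1 + Q s)))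
          ≤ tInt fun x => px S.u s x * S.stress s x := by
        refine tInt_mono (((S.sm_dissip.continuous_x s).const_mul _).sub continuous_const)
          ((S.smu.px.mul S.sm_stress).continuous_x s) fun x hx => ?_
        have hv0 := S.v_pos s x
        have i1 := viscous_sub_pressure_ge (θ := S.θ s x) P (px S.u s x) hc (hv S hS s hs x hx).1
        have i2 : px S.u s x * S.stress s x - μ / 2 * (px S.u s x ^ 2 / S.v s x)
            = (μ * px S.u s x - R * S.θ s x) ^ 2 / (2 * μ * S.v s x)
              - R ^ 2 * S.θ s x ^ 2 / (2 * μ * S.v s x) := by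
          unfold stress
          field_simp
          ring
        have i3 : 0 ≤ (μ * px S.u s x - R * S.θ s x) ^ 2 / (2 * μ * S.v s x) := by positivity
        have i4 : R ^ 2 * S.θ s x ^ 2 / (2 * μ * S.v s x) ≤ R ^ 2 * S.θ s x ^ 2 / (2 * μ * c) := by
          have := (hv S hS s hs x hx).1
          gcongr
        have i5 : R ^ 2 * S.θ s x ^ 2 / (2 * μ * c) = r * S.θ s x ^ 2 := by rw [hr]; ring
        have i6 : r * S.θ s x ^ 2 ≤ r * (C₁ * (1 + Q s)) := by
          have := (hQC s hs).2.1 x hx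
          gcongr
        linarith
      rw [tInt_sub ((S.sm_dissip.continuous_x s).const_mul _) continuous_const, tInt_const] at this
      linarith) ht
  rw [integral_const_mul_one_add cQ, intervalIntegral.integral_const_mul] at h
  have h1 : r * C₁ * (t + ∫ s in (0 : ℝ)..t, Q s) ≤ r * C₁ * (T + C₁) := by
    have := (hQC t ht).1
    have := ht.2
    gcongr
  have h2 : 0 ≤ tInt fun x => S.u t x ^ 2 := tInt_nonneg fun x _ => sq_nonneg _
  unfold L2sq at hu
  calc (∫ s in (0 : ℝ)..t, (tInt fun x => px S.u s x ^ 2 / S.v s x))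
      = 2 / μ * (μ / 2 * ∫ s in (0 : ℝ)..t, (tInt fun x => px S.u s x ^ 2 / S.v s x)) := by
        field_simp
    _ ≤ _ := by
        gcongr
        linarith

theorem integral_px_u_sq_le (P : PosParams μ R a b κ₁ κ₂ β γ T M ε) :
    ∃ C : ℝ, 0 < C ∧ ∀ S : Sol μ R a b κ₁ κ₂ β γ T, S.Bounded M ε → ∀ t ∈ Icc 0 T,
      ∫ s in (0 : ℝ)..t, (tInt fun x => px S.u s x ^ 2) ≤ C := by
  obtain ⟨_, V, _, hV, hv⟩ := v_bounds P
  obtain ⟨C, hC, hd⟩ := integral_dissip_le P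
  refine ⟨V * C, by positivity, fun S hS t ht => ?_⟩
  have h : ∫ s in (0 : ℝ)..t, (tInt fun x => px S.u s x ^ 2)
      ≤ ∫ s in (0 : ℝ)..t, V * (tInt fun x => px S.u s x ^ 2 / S.v s x) := by
    refine intervalIntegral.integral_mono_on ht.1
      ((S.smu.px.pow 2).continuous_tInt.intervalIntegrable _ _)
      ((S.sm_dissip.continuous_tInt.const_mul V).intervalIntegrable _ _) fun s hs => ?_
    rw [← tInt_const_mul]
    refine tInt_mono ((S.smu.px.pow 2).continuous_x s) ((S.sm_dissip.continuous_x s).const_mul V)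
      fun x hx => ?_
    have hv0 := S.v_pos s x
    have hvV := (hv S hS s ⟨hs.1, hs.2.trans ht.2⟩ x hx).2
    rw [mul_div_assoc', le_div_iff₀ hv0]
    nlinarith [sq_nonneg (px S.u s x)]
  rw [intervalIntegral.integral_const_mul] at h
  exact h.trans (by gcongr; exact hd S hS t ht)

/-! ### Gradient of the specific volume -/

theorem tInt_log_px_v_le (P : PosParams μ R a b κ₁ κ₂ β γ T M ε) :
    ∃ C : ℝ, 0 < C ∧ ∀ S : Sol μ R a b κ₁ κ₂ β γ T, S.Bounded M ε → ∀ t ∈ Icc 0 T,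
      (tInt fun x => (px S.v t x / S.v t x) ^ 2) ≤ C := by
  obtain ⟨Θ, hΘ, hE⟩ := energy_bound P
  obtain ⟨c, _, hc, _, hv⟩ := v_bounds P
  obtain ⟨C₁, hC₁, hctrl⟩ := exists_control P
  have hμ := P.hμ
  have hR := P.hR
  have hT := P.hT
  have hε := P.hε
  set K := R / c * (μ * C₁ + (1 + C₁) * Θ / μ) with hK
  have hKp : 0 < K := by positivity
  set N := 2 * μ ^ 2 / ε ^ 2 * M ^ 2 + 2 * M ^ 2 + K * (T + C₁) with hN
  have hNp : 0 < N := by positivity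
  refine ⟨2 / μ ^ 2 * (N + Θ), by positivity, fun S hS t ht => ?_⟩
  obtain ⟨Q, cQ, hQ, hQC⟩ := hctrl S hS
  obtain ⟨⟨-, hvx⟩, ⟨hu, -⟩, -⟩ := hS.L2sq_le P.hM
  have hF := fun s => hasDerivAt_tInt_sq S.sm_effVel s
  have hF' : Continuous fun s => 2 * tInt fun x => S.effVel s x * pt S.effVel s x :=
    (S.sm_effVel.mul S.sm_effVel.pt).continuous_tInt.const_mul _
  have h := sub_le_integral (G := fun s => K * (1 + Q s)) hF hF' (by fun_prop) (fun s hs => by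
    obtain ⟨-, hθ2, hgrad⟩ := hQC s hs
    have hQs := hQ s
    have cg : Continuous fun x => px S.θ s x ^ 2 / S.θ s x :=
      ((S.smθ.px.pow 2).div S.smθ S.θ_pos).continuous_x s
    have cu : Continuous fun x => S.u s x ^ 2 := (S.smu.pow 2).continuous_x s
    have h1 : (tInt fun x => 2 * (S.effVel s x * pt S.effVel s x)) ≤
        tInt fun x => R / c * μ * (px S.θ s x ^ 2 / S.θ s x)
          + R / c / μ * ((1 + C₁) * (1 + Q s)) * S.u s x ^ 2 := by
      refine tInt_mono (((S.sm_effVel.mul S.sm_effVel.pt).continuous_x s).const_mul 2)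
        ((cg.const_mul _).add (cu.const_mul _)) fun x hx => ?_
      have hv0 := S.v_pos s x
      have hθ := S.θ_pos s x
      have hvc := (hv S hS s hs x hx).1
      set w := S.effVel s x with hw
      have hvxw : px S.v s x = S.v s x * (w + S.u s x) / μ := by
        rw [hw]; unfold effVel; field_simp; ring
      have i1 : 2 * (w * pt S.effVel s x) ≤
          R / S.v s x * (μ * (px S.θ s x ^ 2 / S.θ s x) + S.θ s x * S.u s x ^ 2 / μ) := by
        rw [S.pt_effVel hs, hvxw]
        have e : R / S.v s x * (μ * (px S.θ s x ^ 2 / S.θ s x) + S.θ s x * S.u s x ^ 2 / μ)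
            - 2 * (w * (R * px S.θ s x / S.v s x
              - R * S.θ s x * (S.v s x * (w + S.u s x) / μ) / S.v s x ^ 2))
            = R / (S.v s x * μ * S.θ s x) * ((μ * px S.θ s x - S.θ s x * w) ^ 2
              + S.θ s x ^ 2 * (w + S.u s x) ^ 2) := by
          field_simp
          ring
        have : 0 ≤ R / (S.v s x * μ * S.θ s x) * ((μ * px S.θ s x - S.θ s x * w) ^ 2
              + S.θ s x ^ 2 * (w + S.u s x) ^ 2) := by positivity
        linarith
      have i2 : S.θ s x ≤ (1 + C₁) * (1 + Q s) := by
        nlinarith [hθ2 x hx, sq_nonneg (S.θ s x - 1)]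
      calc 2 * (w * pt S.effVel s x) ≤ _ := i1
        _ ≤ R / c * (μ * (px S.θ s x ^ 2 / S.θ s x)
            + (1 + C₁) * (1 + Q s) * S.u s x ^ 2 / μ) := by gcongr
        _ = _ := by ring
    rw [tInt_const_mul, tInt_add (cg.const_mul _) (cu.const_mul _), tInt_const_mul,
      tInt_const_mul] at h1
    have h2 : R / c * μ * (tInt fun x => px S.θ s x ^ 2 / S.θ s x) ≤ R / c * μ * (C₁ * (1 + Q s)) := by
      have : (tInt fun x => px S.θ s x ^ 2 / S.θ s x) ≤ C₁ * (1 + Q s) :=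
        hgrad.trans (by gcongr; linarith)
      gcongr
    have h3 : R / c / μ * ((1 + C₁) * (1 + Q s)) * (tInt fun x => S.u s x ^ 2)
        ≤ R / c / μ * ((1 + C₁) * (1 + Q s)) * Θ := by
      have := (hE S hS s hs).2
      have := hQ s
      gcongr
    refine h1.trans ((add_le_add h2 h3).trans (le_of_eq ?_))
    rw [hK]; field_simp) ht
  rw [integral_const_mul_one_add cQ] at h
  have h1 : K * (t + ∫ s in (0 : ℝ)..t, Q s) ≤ K * (T + C₁) := by
    have := (hQC t ht).1
    have := ht.2
    gcongr
  have h0 : (tInt fun x => S.effVel 0 x ^ 2) ≤ 2 * μ ^ 2 / ε ^ 2 * M ^ 2 + 2 * M ^ 2 := by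
    have cv : Continuous fun x => px S.v 0 x ^ 2 := (S.smv.px.pow 2).continuous_x 0
    have cu : Continuous fun x => S.u 0 x ^ 2 := (S.smu.pow 2).continuous_x 0
    have i1 : (tInt fun x => S.effVel 0 x ^ 2)
        ≤ tInt fun x => 2 * μ ^ 2 / ε ^ 2 * px S.v 0 x ^ 2 + 2 * S.u 0 x ^ 2 := by
      refine tInt_mono ((S.sm_effVel.pow 2).continuous_x 0) ((cv.const_mul _).add (cu.const_mul _))
        fun x _ => ?_
      have hv0 := S.v_pos 0 x
      have hve := hS.2.1 x
      have : S.effVel 0 x ^ 2 ≤ 2 * μ ^ 2 / S.v 0 x ^ 2 * px S.v 0 x ^ 2 + 2 * S.u 0 x ^ 2 := by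
        have e : 2 * μ ^ 2 / S.v 0 x ^ 2 * px S.v 0 x ^ 2 = 2 * (μ * px S.v 0 x / S.v 0 x) ^ 2 := by
          field_simp
        rw [e]; unfold effVel
        nlinarith [sq_nonneg (μ * px S.v 0 x / S.v 0 x + S.u 0 x)]
      refine this.trans ?_
      gcongr
    rw [tInt_add (cv.const_mul _) (cu.const_mul _), tInt_const_mul, tInt_const_mul] at i1
    unfold L2sq at hvx hu
    refine i1.trans ?_
    gcongr
  have hwN : (tInt fun x => S.effVel t x ^ 2) ≤ N := by rw [hN]; linarith
  have cw : Continuous fun x => S.effVel t x ^ 2 := (S.sm_effVel.pow 2).continuous_x t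
  have cu : Continuous fun x => S.u t x ^ 2 := (S.smu.pow 2).continuous_x t
  have h2 : (tInt fun x => (px S.v t x / S.v t x) ^ 2)
      ≤ tInt fun x => 2 / μ ^ 2 * (S.effVel t x ^ 2 + S.u t x ^ 2) := by
    refine tInt_mono (((S.smv.px.div S.smv S.v_pos).pow 2).continuous_x t)
      ((cw.add cu).const_mul _) fun x _ => ?_
    have hv0 := S.v_pos t x
    have e : px S.v t x / S.v t x = (S.effVel t x + S.u t x) / μ := by
      unfold effVel; field_simp; ring
    rw [e, div_pow, div_mul_eq_mul_div]
    gcongr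
    nlinarith [sq_nonneg (S.effVel t x - S.u t x)]
  rw [tInt_const_mul, tInt_add cw cu] at h2
  refine h2.trans ?_
  have := (hE S hS t ht).2
  gcongr

/-! ### Sup bounds for the velocity gradient -/

variable (S) in
theorem px_u_sq_le (t : ℝ) {x : ℝ} (hx : x ∈ cell) :
    px S.u t x ^ 2 ≤ 2 * tInt fun z => |px S.u t z| * |px (px S.u) t z| := by
  have hper : S.u t (-(1 / 2)) = S.u t (1 / 2) := by
    have := S.periodic_u t (-(1 / 2))
    norm_num at this ⊢
    exact this.symm
  obtain ⟨y, hy, hy0⟩ := exists_hasDerivAt_eq_zero (by norm_num : (-(1 / 2) : ℝ) < 1 / 2)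
    (S.smu.continuous_x t).continuousOn hper fun z _ => S.smu.hasDerivAt_px t z
  have c1 := S.smu.px.continuous_x t
  have c2 := S.smu.px.px.continuous_x t
  have h := sub_le_tInt_abs_deriv (f := fun z => px S.u t z ^ 2)
    (g := fun z => 2 * (px S.u t z * px (px S.u) t z)) (fun z => by
      refine ((S.smu.px.hasDerivAt_px t z).pow 2).congr_deriv ?_
      norm_num; ring) (by fun_prop) hx (Ioo_subset_Icc_self hy)
  rw [hy0, ← tInt_const_mul] at *
  refine le_trans (le_of_eq (by ring)) (h.trans (le_of_eq ?_))
  congr 1; ext z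
  rw [abs_mul, abs_mul, abs_two]

variable (S) in
theorem px_u_sq_le_add (t : ℝ) {l : ℝ} (hl : 0 < l) {x : ℝ} (hx : x ∈ cell) :
    px S.u t x ^ 2 ≤ l * (tInt fun x => px (px S.u) t x ^ 2)
      + 1 / l * tInt fun x => px S.u t x ^ 2 := by
  have c1 := S.smu.px.continuous_x t
  have c2 := S.smu.px.px.continuous_x t
  refine (S.px_u_sq_le t hx).trans ?_
  rw [← tInt_const_mul, ← tInt_const_mul, ← tInt_const_mul,
    ← tInt_add (by fun_prop) (by fun_prop)]
  refine tInt_mono (by fun_prop) (by fun_prop) fun z _ => ?_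
  have e : l * px (px S.u) t z ^ 2 + 1 / l * px S.u t z ^ 2
      - 2 * (|px S.u t z| * |px (px S.u) t z|)
      = 1 / l * (l * |px (px S.u) t z| - |px S.u t z|) ^ 2 := by
    rw [← sq_abs (px (px S.u) t z), ← sq_abs (px S.u t z)]
    field_simp
    ring
  have : 0 ≤ 1 / l * (l * |px (px S.u) t z| - |px S.u t z|) ^ 2 := by positivity
  linarith

variable (S) in
theorem px_u_pow_four_le (t : ℝ) {x : ℝ} (hx : x ∈ cell) :
    px S.u t x ^ 4 ≤ 4 * ((tInt fun x => px S.u t x ^ 2) * tInt fun x => px (px S.u) t x ^ 2) := by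
  have c1 := S.smu.px.continuous_x t
  have c2 := S.smu.px.px.continuous_x t
  have h1 := S.px_u_sq_le t hx
  have h2 := tInt_sq_le c1.abs c2.abs
  simp only [sq_abs] at h2
  have h3 : px S.u t x ^ 4 = (px S.u t x ^ 2) ^ 2 := by ring
  rw [h3]
  nlinarith [sq_nonneg (px S.u t x)]

variable (S) in
theorem tInt_px_u_sq_sq_le (t : ℝ) :
    (tInt fun x => px S.u t x ^ 2) ^ 2
      ≤ (tInt fun x => S.u t x ^ 2) * tInt fun x => px (px S.u) t x ^ 2 := by
  have c0 := S.smu.continuous_x t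
  have c1 := S.smu.px.continuous_x t
  have c2 := S.smu.px.px.continuous_x t
  have h := (S.smu.mul S.smu.px).tInt_px t
  have e : px (fun t x => S.u t x * px S.u t x) t = fun x =>
      px S.u t x ^ 2 + S.u t x * px (px S.u) t x := by
    ext x
    refine ((S.smu.hasDerivAt_px t x).mul (S.smu.px.hasDerivAt_px t x)).deriv.trans ?_
    ring
  rw [e, tInt_add (by fun_prop) (by fun_prop)] at h
  have h2 := tInt_sq_le c0 c2
  have h3 : (tInt fun x => px S.u t x ^ 2) = -tInt fun x => S.u t x * px (px S.u) t x := by linarith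
  rw [h3, neg_sq]
  exact h2

/-! ### The coupled gradient estimate -/

variable (S) in
/-- The conductive dissipation `∫ κ θ_x² / v`. -/
def heatDissip (t : ℝ) : ℝ := tInt fun x => S.cond t x * px S.θ t x ^ 2 / S.v t x

variable (S) in
theorem sm_heatDissip : Sm fun t x => S.cond t x * px S.θ t x ^ 2 / S.v t x :=
  (S.sm_cond.mul (S.smθ.px.pow 2)).div S.smv S.v_pos

variable (S) in
/-- The dissipation `∫ u_xx²`. -/
def accelDissip (t : ℝ) : ℝ := tInt fun x => px (px S.u) t x ^ 2

variable (S) in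
theorem continuous_heatDissip : Continuous S.heatDissip := S.sm_heatDissip.continuous_tInt

variable (S) in
theorem continuous_accelDissip : Continuous S.accelDissip := (S.smu.px.px.pow 2).continuous_tInt

theorem heatDissip_nonneg (P : PosParams μ R a b κ₁ κ₂ β γ T M ε) (t : ℝ) : 0 ≤ S.heatDissip t :=
  tInt_nonneg fun x _ => by
    have := S.cond_nonneg P t x
    have := S.v_pos t x
    positivity

variable (S) in
theorem accelDissip_nonneg (t : ℝ) : 0 ≤ S.accelDissip t := tInt_nonneg fun _ _ => sq_nonneg _

/-- Pointwise Young inequality for `-u_xx u_t`. -/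
theorem neg_mul_pt_u_le (P : PosParams μ R a b κ₁ κ₂ β γ T M ε) {t : ℝ} (ht : t ∈ Icc 0 T) (x : ℝ) :
    -(2 * (px (px S.u) t x * pt S.u t x)) ≤ 1 / S.v t x * (-μ * px (px S.u) t x ^ 2
      + 4 * μ * (px S.u t x ^ 2 * (px S.v t x / S.v t x) ^ 2)
      + 4 * R ^ 2 / μ * (px S.θ t x ^ 2 + S.θ t x ^ 2 * (px S.v t x / S.v t x) ^ 2)) := by
  have hμ := P.hμ
  have hv := S.v_pos t x
  rw [S.pt_u ht]
  set y := px S.v t x / S.v t x with hy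
  have e : px S.v t x = S.v t x * y := by rw [hy]; field_simp
  rw [e]
  set A := px (px S.u) t x
  set z := px S.u t x
  set g := px S.θ t x
  set θ := S.θ t x
  set v := S.v t x
  have key : 1 / v * (-μ * A ^ 2 + 4 * μ * (z ^ 2 * y ^ 2) + 4 * R ^ 2 / μ * (g ^ 2 + θ ^ 2 * y ^ 2))
      - -(2 * (A * (μ * A / v - μ * z * (v * y) / v ^ 2 - (R * g / v - R * θ * (v * y) / v ^ 2))))
      = 1 / (v * μ) * ((μ * A / 2 - 2 * (μ * z * y)) ^ 2 + (μ * A / 2 - 2 * (R * g)) ^ 2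
        + (μ * A / 2 + 2 * (R * θ * y)) ^ 2 + (μ * A / 2) ^ 2) := by
    field_simp
    ring
  have : 0 ≤ 1 / (v * μ) * ((μ * A / 2 - 2 * (μ * z * y)) ^ 2 + (μ * A / 2 - 2 * (R * g)) ^ 2
        + (μ * A / 2 + 2 * (R * θ * y)) ^ 2 + (μ * A / 2) ^ 2) := by positivity
  linarith

/-- Growth of `∫ u_x²`, in terms of a pointwise bound `B` for `u_x²` and `D` for `θ²`. -/
theorem deriv_tInt_px_u_sq_le (P : PosParams μ R a b κ₁ κ₂ β γ T M ε) {t : ℝ} (ht : t ∈ Icc 0 T)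
    {c V Y B D : ℝ} (hc : 0 < c) (hV : 0 < V) (hv : ∀ x ∈ cell, c ≤ S.v t x ∧ S.v t x ≤ V)
    (hY : (tInt fun x => (px S.v t x / S.v t x) ^ 2) ≤ Y) (hB0 : 0 ≤ B) (hD0 : 0 ≤ D)
    (hB : ∀ x ∈ cell, px S.u t x ^ 2 ≤ B) (hD : ∀ x ∈ cell, S.θ t x ^ 2 ≤ D) :
    2 * (tInt fun x => px S.u t x * pt (px S.u) t x) ≤ -(μ / V) * S.accelDissip t
      + 4 * R ^ 2 / (μ * c) * (V / κ₁) * S.heatDissip t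
      + 4 / c * (μ * B + R ^ 2 / μ * D) * Y := by
  have hμ := P.hμ
  have hR := P.hR
  have hκ₁ := P.hκ₁
  have hκ₂ := P.hκ₂
  have c1 : Continuous fun x => px (px S.u) t x ^ 2 := (S.smu.px.px.pow 2).continuous_x t
  have c2 := S.sm_heatDissip.continuous_x t
  have c3 : Continuous fun x => (px S.v t x / S.v t x) ^ 2 :=
    ((S.smv.px.div S.smv S.v_pos).pow 2).continuous_x t
  have h : (tInt fun x => -2 * (px (px S.u) t x * pt S.u t x)) ≤ tInt fun x =>
      (-(μ / V) * px (px S.u) t x ^ 2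
        + 4 * R ^ 2 / (μ * c) * (V / κ₁) * (S.cond t x * px S.θ t x ^ 2 / S.v t x))
        + 4 / c * (μ * B + R ^ 2 / μ * D) * (px S.v t x / S.v t x) ^ 2 := by
    refine tInt_mono (((S.smu.px.px.mul S.smu.pt).continuous_x t).const_mul _) (by fun_prop)
      fun x hx => ?_
    have hv0 := S.v_pos t x
    have hθ := S.θ_pos t x
    obtain ⟨hvc, hvV⟩ := hv x hx
    have h1 := S.neg_mul_pt_u_le P ht x
    set y := px S.v t x / S.v t x
    have h2 : μ / V * px (px S.u) t x ^ 2 ≤ 1 / S.v t x * (μ * px (px S.u) t x ^ 2) := by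
      rw [one_div_mul_eq_div, div_mul_eq_mul_div]
      gcongr
    have h3 : 1 / S.v t x * (4 * μ * (px S.u t x ^ 2 * y ^ 2)) ≤ 1 / c * (4 * μ * (B * y ^ 2)) := by
      have := hB x hx
      gcongr
    have h4 : 1 / S.v t x * (4 * R ^ 2 / μ * (S.θ t x ^ 2 * y ^ 2))
        ≤ 1 / c * (4 * R ^ 2 / μ * (D * y ^ 2)) := by
      have := hD x hx
      gcongr
    have h5 : px S.θ t x ^ 2 ≤ V / κ₁ * (S.cond t x * px S.θ t x ^ 2 / S.v t x) := by
      have i1 : κ₁ ≤ S.cond t x := by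
        have := rpow_pos_of_pos hθ β
        unfold cond kappa
        have : 0 < κ₂ * S.v t x * S.θ t x ^ β := by positivity
        linarith
      have i2 : κ₁ * px S.θ t x ^ 2 / V ≤ S.cond t x * px S.θ t x ^ 2 / S.v t x :=
        div_le_div₀ (mul_nonneg (P.hκ₁.le.trans i1) (sq_nonneg _)) (by gcongr) hv0 hvV
      calc px S.θ t x ^ 2 = V / κ₁ * (κ₁ * px S.θ t x ^ 2 / V) := by field_simp
        _ ≤ _ := by gcongr
    have h6 : 1 / S.v t x * (4 * R ^ 2 / μ * px S.θ t x ^ 2)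
        ≤ 1 / c * (4 * R ^ 2 / μ * (V / κ₁ * (S.cond t x * px S.θ t x ^ 2 / S.v t x))) := by
      gcongr
    have e1 : 1 / c * (4 * μ * (B * y ^ 2)) + 1 / c * (4 * R ^ 2 / μ * (D * y ^ 2))
        = 4 / c * (μ * B + R ^ 2 / μ * D) * y ^ 2 := by ring
    have e2 : 1 / c * (4 * R ^ 2 / μ * (V / κ₁ * (S.cond t x * px S.θ t x ^ 2 / S.v t x)))
        = 4 * R ^ 2 / (μ * c) * (V / κ₁) * (S.cond t x * px S.θ t x ^ 2 / S.v t x) := by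
      field_simp
    linarith
  rw [tInt_const_mul, tInt_add (by fun_prop) (by fun_prop), tInt_add (by fun_prop) (by fun_prop),
    tInt_const_mul, tInt_const_mul, tInt_const_mul] at h
  rw [S.tInt_px_u_mul]
  have h7 : 4 / c * (μ * B + R ^ 2 / μ * D) * (tInt fun x => (px S.v t x / S.v t x) ^ 2)
      ≤ 4 / c * (μ * B + R ^ 2 / μ * D) * Y := by gcongr
  unfold accelDissip heatDissip
  linarith

/-- Growth of `∫ θ²`, with the same pointwise bounds. -/
theorem deriv_tInt_θ_sq_le (P : PosParams μ R a b κ₁ κ₂ β γ T M ε) {t : ℝ} (ht : t ∈ Icc 0 T)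
    {c Θ B D : ℝ} (hc : 0 < c) (hv : ∀ x ∈ cell, c ≤ S.v t x) (hΘ : tInt (S.θ t) ≤ Θ) (hB0 : 0 ≤ B)
    (hD0 : 0 ≤ D)
    (hB : ∀ x ∈ cell, px S.u t x ^ 2 ≤ B) (hD : ∀ x ∈ cell, S.θ t x ^ 2 ≤ D) :
    R / (γ - 1) * (tInt fun x => S.θ t x * pt S.θ t x) ≤
      1 / c * ((μ + R) * B + R * D) * Θ - S.heatDissip t := by
  have hμ := P.hμ
  have hR := P.hR
  have e1 := S.tInt_rpow_mul_pt_θ ht 1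
  have e2 := S.tInt_rpow_mul_px_q P ht 1
  simp only [rpow_one, sub_self, rpow_zero, one_mul] at e1 e2
  have e3 : (tInt fun x => px S.θ t x * S.flux t x) = S.heatDissip t := by
    unfold heatDissip; congr 1; ext x; unfold flux; ring
  rw [e3] at e1
  have h : (tInt fun x => S.θ t x * (μ * px S.u t x ^ 2 / S.v t x
        - R * S.θ t x * px S.u t x / S.v t x)) ≤
      tInt fun x => 1 / c * ((μ + R) * B + R * D) * S.θ t x := by
    refine tInt_mono ?_ ((S.smθ.continuous_x t).const_mul _) fun x hx => ?_
    · exact (S.smθ.mul ((((Sm.const μ).mul (S.smu.px.pow 2)).div S.smv S.v_pos).sub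
        ((((Sm.const R).mul S.smθ).mul S.smu.px).div S.smv S.v_pos))).continuous_x t
    have hv0 := S.v_pos t x
    have hθ := S.θ_pos t x
    have hvc := hv x hx
    have h1 : μ * px S.u t x ^ 2 - R * S.θ t x * px S.u t x ≤ (μ + R) * B + R * D := by
      have i1 := mul_le_mul_of_nonneg_left (hB x hx) hμ.le
      have i2 : -(S.θ t x * px S.u t x) ≤ B + D := by
        nlinarith [hB x hx, hD x hx, sq_nonneg (S.θ t x + px S.u t x), sq_nonneg (S.θ t x),
          sq_nonneg (px S.u t x)]
      have i3 := mul_le_mul_of_nonneg_left i2 hR.le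
      linarith
    have h2 : 0 ≤ (μ + R) * B + R * D := by positivity
    calc S.θ t x * (μ * px S.u t x ^ 2 / S.v t x - R * S.θ t x * px S.u t x / S.v t x)
        = S.θ t x * ((μ * px S.u t x ^ 2 - R * S.θ t x * px S.u t x) / S.v t x) := by ring
      _ ≤ S.θ t x * (((μ + R) * B + R * D) / S.v t x) := by gcongr
      _ ≤ S.θ t x * (((μ + R) * B + R * D) / c) := by gcongr
      _ = _ := by ring
  rw [tInt_const_mul] at h
  have h3 : 1 / c * ((μ + R) * B + R * D) * (tInt fun x => S.θ t x)
      ≤ 1 / c * ((μ + R) * B + R * D) * Θ := by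
    have : (tInt fun x => S.θ t x) ≤ Θ := hΘ
    gcongr
  linarith

theorem gradient_bounds (P : PosParams μ R a b κ₁ κ₂ β γ T M ε) :
    ∃ C : ℝ, 0 < C ∧ ∀ S : Sol μ R a b κ₁ κ₂ β γ T, S.Bounded M ε → ∀ t ∈ Icc 0 T,
      (tInt fun x => px S.u t x ^ 2) ≤ C ∧ (tInt fun x => S.θ t x ^ 2) ≤ C ∧
      ∫ s in (0 : ℝ)..t, S.accelDissip s ≤ C ∧ ∫ s in (0 : ℝ)..t, S.heatDissip s ≤ C := by
  obtain ⟨Θ, hΘ, hE⟩ := energy_bound P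
  obtain ⟨c, V, hc, hV, hv⟩ := v_bounds P
  obtain ⟨C₁, hC₁, hctrl⟩ := exists_control P
  obtain ⟨G₁, hG₁, hG⟩ := integral_px_u_sq_le P
  obtain ⟨Y, hY, hYb⟩ := tInt_log_px_v_le P
  have hμ := P.hμ
  have hR := P.hR
  have hT := P.hT
  have hκ₁ := P.hκ₁
  have hcv := P.cv_pos
  set k := R / (γ - 1)
  set K := 1 + 4 * R ^ 2 / (μ * c) * (V / κ₁) with hK
  have hKp : 0 < K := by positivity
  set N := 4 / c * μ * Y + K * (1 / c * (μ + R) * Θ) with hN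
  have hNp : 0 < N := by positivity
  set l := μ / (2 * V * N) with hl
  have hlp : 0 < l := by positivity
  set J := (4 / c * (R ^ 2 / μ) * Y + K * (1 / c * R * Θ)) * C₁ with hJ
  have hJp : 0 < J := by positivity
  set L := J + N / l with hL
  have hLp : 0 < L := by positivity
  set X := M ^ 2 + K * k / 2 * M ^ 2 + L * (T + (C₁ + G₁)) with hX
  have hXp : 0 < X := by positivity
  refine ⟨X + 2 / (K * k) * X + 2 * V / μ * X, by positivity, fun S hS t ht => ?_⟩
  obtain ⟨Q, cQ, hQ, hQC⟩ := hctrl S hS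
  obtain ⟨-, ⟨-, hux⟩, ⟨hθ0, -⟩⟩ := hS.L2sq_le P.hM
  have cG : Continuous fun s => tInt fun x => px S.u s x ^ 2 := (S.smu.px.pow 2).continuous_tInt
  have cA := S.continuous_accelDissip
  have cH := S.continuous_heatDissip
  have hF := fun s => (hasDerivAt_tInt_sq S.smu.px s).add
    ((hasDerivAt_tInt_sq S.smθ s).const_mul (K * k / 2))
  have hF' : Continuous fun s => 2 * (tInt fun x => px S.u s x * pt (px S.u) s x)
      + K * k / 2 * (2 * tInt fun x => S.θ s x * pt S.θ s x) :=
    ((S.smu.px.mul S.smu.px.pt).continuous_tInt.const_mul _).add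
      (((S.smθ.mul S.smθ.pt).continuous_tInt.const_mul _).const_mul _)
  have cQG : Continuous fun s => Q s + tInt fun x => px S.u s x ^ 2 := cQ.add cG
  have h := add_integral_le (D := fun s => μ / (2 * V) * S.accelDissip s + S.heatDissip s)
    (G := fun s => L * (1 + (Q s + tInt fun x => px S.u s x ^ 2))) hF hF' (by fun_prop)
    ((cQG.const_add 1).const_mul L) (fun s hs => by
      obtain ⟨-, hθ2, -⟩ := hQC s hs
      have hQs := hQ s
      have hA := S.accelDissip_nonneg s
      have hG0 : 0 ≤ tInt fun x => px S.u s x ^ 2 := tInt_nonneg fun _ _ => sq_nonneg _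
      set G := tInt fun x => px S.u s x ^ 2
      set B := l * S.accelDissip s + 1 / l * G with hB
      have hBx : ∀ x ∈ cell, px S.u s x ^ 2 ≤ B := fun x hx => S.px_u_sq_le_add s hlp hx
      have hB0 : 0 ≤ B := by positivity
      have h1 := deriv_tInt_px_u_sq_le P hs hc hV (hv S hS s hs) (hYb S hS s hs) hB0
        (by positivity : 0 ≤ C₁ * (1 + Q s)) hBx hθ2
      have h2 := deriv_tInt_θ_sq_le P hs hc (fun x hx => (hv S hS s hs x hx).1) (hE S hS s hs).1 hB0
        (by positivity : 0 ≤ C₁ * (1 + Q s)) hBx hθ2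
      have h3 := mul_le_mul_of_nonneg_left h2 hKp.le
      have e1 : N * B = μ / (2 * V) * S.accelDissip s + N / l * G := by
        have : N * l = μ / (2 * V) := by rw [hl]; field_simp
        rw [hB, ← this]; ring
      have e2 : K * S.heatDissip s = S.heatDissip s
          + 4 * R ^ 2 / (μ * c) * (V / κ₁) * S.heatDissip s := by rw [hK]; ring
      have e3 : 4 / c * (μ * B + R ^ 2 / μ * (C₁ * (1 + Q s))) * Y
          + K * (1 / c * ((μ + R) * B + R * (C₁ * (1 + Q s))) * Θ) = N * B + J * (1 + Q s) := by
        rw [hN, hJ]; ring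
      have e4 : μ / V * S.accelDissip s = 2 * (μ / (2 * V) * S.accelDissip s) := by
        field_simp
      have e5 : L * (1 + (Q s + G)) = J * (1 + Q s) + N / l * G + (J * G + N / l * (1 + Q s)) := by
        rw [hL]; ring
      have h4 : 0 ≤ J * G + N / l * (1 + Q s) := by positivity
      have e6 : K * (k * tInt fun x => S.θ s x * pt S.θ s x)
          = K * k / 2 * (2 * tInt fun x => S.θ s x * pt S.θ s x) := by ring
      linarith) ht
  rw [integral_const_mul_one_add cQG, intervalIntegral.integral_add
    (cQ.intervalIntegrable _ _) (cG.intervalIntegrable _ _), intervalIntegral.integral_add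
    (Continuous.intervalIntegrable (by fun_prop) _ _) (cH.intervalIntegrable _ _),
    intervalIntegral.integral_const_mul] at h
  have h1 : L * (t + ((∫ s in (0 : ℝ)..t, Q s) + ∫ s in (0 : ℝ)..t, tInt fun x => px S.u s x ^ 2))
      ≤ L * (T + (C₁ + G₁)) := by
    have := (hQC t ht).1
    have := hG S hS t ht
    have := ht.2
    gcongr
  unfold L2sq at hux hθ0
  have h2 : K * k / 2 * (tInt fun x => S.θ 0 x ^ 2) ≤ K * k / 2 * M ^ 2 := by gcongr
  set E₁ := tInt fun x => px S.u t x ^ 2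
  set E₂ := tInt fun x => S.θ t x ^ 2
  set I₁ := ∫ s in (0 : ℝ)..t, S.accelDissip s
  set I₂ := ∫ s in (0 : ℝ)..t, S.heatDissip s
  have p1 : 0 ≤ E₁ := tInt_nonneg fun _ _ => sq_nonneg _
  have p2 : 0 ≤ E₂ := tInt_nonneg fun _ _ => sq_nonneg _
  have p3 : 0 ≤ I₁ := intervalIntegral.integral_nonneg ht.1 fun s _ => S.accelDissip_nonneg s
  have p4 : 0 ≤ I₂ := intervalIntegral.integral_nonneg ht.1 fun s _ => S.heatDissip_nonneg P s
  have hsum : E₁ + K * k / 2 * E₂ + (μ / (2 * V) * I₁ + I₂) ≤ X := by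
    rw [hX]; simp only [Pi.add_apply] at h; linarith
  have q2 : 0 ≤ K * k / 2 * E₂ := by positivity
  have q3 : 0 ≤ μ / (2 * V) * I₁ := by positivity
  have x1 : 0 ≤ 2 / (K * k) * X := by positivity
  have x2 : 0 ≤ 2 * V / μ * X := by positivity
  refine ⟨by linarith, ?_, ?_, by linarith⟩
  · have : E₂ = 2 / (K * k) * (K * k / 2 * E₂) := by field_simp
    have h5 : 2 / (K * k) * (K * k / 2 * E₂) ≤ 2 / (K * k) * X := by
      gcongr
      linarith
    linarith
  · have : I₁ = 2 * V / μ * (μ / (2 * V) * I₁) := by field_simp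
    have h5 : 2 * V / μ * (μ / (2 * V) * I₁) ≤ 2 * V / μ * X := by
      gcongr
      linarith
    linarith

/-! ### A high moment of the temperature -/

theorem hasDerivAt_tInt_θ_pow (S : Sol μ R a b κ₁ κ₂ β γ T) (t : ℝ) :
    HasDerivAt (fun s => tInt fun x => S.θ s x ^ 8)
      (8 * tInt fun x => S.θ t x ^ (7 : ℝ) * pt S.θ t x) t := by
  have h := S.hasDerivAt_tInt_rpow 7 t
  norm_num at h
  simpa only [rpow_ofNat] using h

theorem deriv_tInt_θ_pow_le (P : PosParams μ R a b κ₁ κ₂ β γ T M ε) {t : ℝ} (ht : t ∈ Icc 0 T)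
    {c B : ℝ} (hc : 0 < c) (hv : ∀ x ∈ cell, c ≤ S.v t x)
    (hB0 : 0 ≤ B) (hB : ∀ x ∈ cell, px S.u t x ^ 2 ≤ B) :
    R / (γ - 1) * (tInt fun x => S.θ t x ^ (7 : ℝ) * pt S.θ t x) ≤
      (μ + R) / c * (1 + B) * (1 + tInt fun x => S.θ t x ^ 8) := by
  have hμ := P.hμ
  have hR := P.hR
  have e1 := S.tInt_rpow_mul_pt_θ ht 7
  have e2 := S.tInt_rpow_mul_px_q P ht 7
  have e3 : 0 ≤ tInt fun x => S.θ t x ^ ((7 : ℝ) - 1) * px S.θ t x * S.flux t x := by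
    have := S.entropyDissip_nonneg P (-7) t
    unfold entropyDissip at this
    norm_num at this ⊢
    exact this
  have c0 : Continuous fun x => S.θ t x ^ 8 := (S.smθ.pow 8).continuous_x t
  have h : (tInt fun x => S.θ t x ^ (7 : ℝ) * (μ * px S.u t x ^ 2 / S.v t x
        - R * S.θ t x * px S.u t x / S.v t x)) ≤
      tInt fun x => (μ + R) / c * (1 + B) * (1 + S.θ t x ^ 8) := by
    refine tInt_mono ?_ (by fun_prop) fun x hx => ?_
    · exact ((S.smθ.rpow S.θ_pos 7).mul ((((Sm.const μ).mul (S.smu.px.pow 2)).div S.smv S.v_pos).sub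
        ((((Sm.const R).mul S.smθ).mul S.smu.px).div S.smv S.v_pos))).continuous_x t
    have hv0 := S.v_pos t x
    have hθ := S.θ_pos t x
    have hvc := hv x hx
    have hBx := hB x hx
    rw [rpow_ofNat]
    set θ := S.θ t x
    set z := px S.u t x
    have i1 : θ ^ 7 ≤ 1 + θ ^ 8 := by
      rcases le_total θ 1 with h | h
      · have := pow_le_one₀ (n := 7) hθ.le h
        have : 0 < θ ^ 8 := by positivity
        linarith
      · have := pow_le_pow_right₀ h (by norm_num : 7 ≤ 8)
        linarith
    have i2 : -z ≤ 1 + B := by nlinarith [sq_nonneg (z + 1)]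
    have i3 : θ ^ 7 * (μ * z ^ 2) ≤ (1 + θ ^ 8) * (μ * (1 + B)) := by
      gcongr
      linarith
    have i4 : θ ^ 8 * (R * -z) ≤ (1 + θ ^ 8) * (R * (1 + B)) := by
      calc θ ^ 8 * (R * -z) ≤ θ ^ 8 * (R * (1 + B)) := by gcongr
        _ ≤ _ := by
          gcongr
          linarith
    calc θ ^ 7 * (μ * z ^ 2 / S.v t x - R * θ * z / S.v t x)
        = (θ ^ 7 * (μ * z ^ 2) + θ ^ 8 * (R * -z)) / S.v t x := by ring
      _ ≤ ((1 + θ ^ 8) * (μ * (1 + B)) + (1 + θ ^ 8) * (R * (1 + B))) / S.v t x := by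
        gcongr
      _ ≤ ((1 + θ ^ 8) * (μ * (1 + B)) + (1 + θ ^ 8) * (R * (1 + B))) / c := by gcongr
      _ = _ := by ring
  rw [tInt_const_mul, tInt_add continuous_const c0, tInt_const] at h
  have e4 : 0 ≤ 7 * tInt fun x => S.θ t x ^ ((7 : ℝ) - 1) * px S.θ t x * S.flux t x := by
    positivity
  have e5 : 0 ≤ tInt fun x => S.θ t x ^ (7 : ℝ) * px S.q t x :=
    (mul_nonneg_iff_of_pos_left (by norm_num)).1 e2
  rw [e1]
  exact (sub_le_self _ e4).trans ((sub_le_self _ e5).trans h)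

theorem tInt_θ_pow_le (P : PosParams μ R a b κ₁ κ₂ β γ T M ε) :
    ∃ C : ℝ, 0 < C ∧ ∀ S : Sol μ R a b κ₁ κ₂ β γ T, S.Bounded M ε → ∀ t ∈ Icc 0 T,
      (tInt fun x => S.θ t x ^ 8) ≤ C := by
  obtain ⟨c, _, hc, _, hv⟩ := v_bounds P
  obtain ⟨C, hC, hgrad⟩ := gradient_bounds P
  have hμ := P.hμ
  have hR := P.hR
  have hT := P.hT
  have hM := P.hM
  have hcv := P.cv_pos
  set k := R / (γ - 1)
  set L := 8 / k * ((μ + R) / c * (1 + C)) with hL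
  have hLp : 0 < L := by positivity
  set y₀ := (2 * (1 + M ^ 2)) ^ 8 with hy₀
  refine ⟨exp (log (1 + y₀) + L * (T + C)), exp_pos _, fun S hS t ht => ?_⟩
  have hy : ∀ s, 0 ≤ tInt fun x => S.θ s x ^ 8 := fun s =>
    tInt_nonneg fun x _ => pow_nonneg (S.θ_pos s x).le 8
  have hpos : ∀ s, 0 < 1 + tInt fun x => S.θ s x ^ 8 := fun s => by linarith [hy s]
  have cA := S.continuous_accelDissip
  have cy : Continuous fun s => tInt fun x => S.θ s x ^ 8 := (S.smθ.pow 8).continuous_tInt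
  have h := sub_le_integral (G := fun s => L * (1 + S.accelDissip s))
    (fun s => ((S.hasDerivAt_tInt_θ_pow s).const_add 1).log (hpos s).ne')
    ((((S.smθ.rpow S.θ_pos 7).mul S.smθ.pt).continuous_tInt.const_mul 8).div (by fun_prop)
      fun s => (hpos s).ne') (by fun_prop) (fun s hs => by
      rw [div_le_iff₀ (hpos s)]
      have hA := S.accelDissip_nonneg s
      have hG0 : 0 ≤ tInt fun x => px S.u s x ^ 2 := tInt_nonneg fun _ _ => sq_nonneg _
      have hGC := (hgrad S hS s hs).1
      have h1 := deriv_tInt_θ_pow_le P hs hc (fun x hx => (hv S hS s hs x hx).1)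
        (B := 1 * S.accelDissip s + 1 / 1 * tInt fun x => px S.u s x ^ 2) (by positivity)
        fun x hx => S.px_u_sq_le_add s one_pos hx
      have hp := hpos s
      set y := tInt fun x => S.θ s x ^ 8
      set D := tInt fun x => S.θ s x ^ (7 : ℝ) * pt S.θ s x
      have h2 : k * D ≤ (μ + R) / c * ((1 + C) * (1 + S.accelDissip s)) * (1 + y) := by
        refine h1.trans ?_
        gcongr
        nlinarith
      calc 8 * D = 8 / k * (k * D) := by field_simp
        _ ≤ 8 / k * ((μ + R) / c * ((1 + C) * (1 + S.accelDissip s)) * (1 + y)) := by gcongr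
        _ = _ := by rw [hL]; ring) ht
  rw [integral_const_mul_one_add cA] at h
  have h0 : (tInt fun x => S.θ 0 x ^ 8) ≤ y₀ := by
    rw [← tInt_const y₀]
    refine tInt_mono ((S.smθ.pow 8).continuous_x 0) continuous_const fun x hx => ?_
    exact pow_le_pow_left₀ (S.θ_pos 0 x).le (hS.θ_le hM hx) 8
  have h1 : log (1 + tInt fun x => S.θ 0 x ^ 8) ≤ log (1 + y₀) :=
    log_le_log (hpos 0) (by linarith)
  have h2 : L * (t + ∫ s in (0 : ℝ)..t, S.accelDissip s) ≤ L * (T + C) := by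
    have := (hgrad S hS t ht).2.2.1
    have := ht.2
    gcongr
  have h3 := (log_le_iff_le_exp (hpos t)).1 (by linarith :
    log (1 + tInt fun x => S.θ t x ^ 8) ≤ log (1 + y₀) + L * (T + C))
  linarith

theorem integral_radiation_le (P : PosParams μ R a b κ₁ κ₂ β γ T M ε) :
    ∃ C : ℝ, 0 < C ∧ ∀ S : Sol μ R a b κ₁ κ₂ β γ T, S.Bounded M ε → ∀ t ∈ Icc 0 T,
      (∫ s in (0 : ℝ)..t, (tInt fun x => px S.q s x ^ 2 / S.v s x)
        + tInt fun x => S.v s x * S.q s x ^ 2) ≤ C := by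
  obtain ⟨_, V, _, hV, hv⟩ := v_bounds P
  obtain ⟨C, hC, hθ⟩ := tInt_θ_pow_le P
  have ha := P.ha
  have hb := P.hb
  have hT := P.hT
  set L := (1 + 1 / (2 * a)) * (b ^ 2 * (V * C)) with hL
  have hLp : 0 < L := by positivity
  refine ⟨T * L, by positivity, fun S hS t ht => ?_⟩
  have c1 : Continuous fun s => (tInt fun x => px S.q s x ^ 2 / S.v s x)
        + tInt fun x => S.v s x * S.q s x ^ 2 :=
    S.sm_q_dissip.continuous_tInt.add (S.smv.mul (S.smq.pow 2)).continuous_tInt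
  have h : (∫ s in (0 : ℝ)..t, (tInt fun x => px S.q s x ^ 2 / S.v s x)
        + tInt fun x => S.v s x * S.q s x ^ 2) ≤ ∫ s in (0 : ℝ)..t, L := by
    refine intervalIntegral.integral_mono_on ht.1 (c1.intervalIntegrable _ _)
      (continuous_const.intervalIntegrable _ _) fun s hs => ?_
    have hs' : s ∈ Icc 0 T := ⟨hs.1, hs.2.trans ht.2⟩
    have h1 := S.tInt_q_le hs'
    have h2 : (tInt fun x => S.v s x * S.θ s x ^ 8) ≤ V * C := by
      have : (tInt fun x => S.v s x * S.θ s x ^ 8) ≤ tInt fun x => V * S.θ s x ^ 8 := by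
        refine tInt_mono ((S.smv.mul (S.smθ.pow 8)).continuous_x s)
          (((S.smθ.pow 8).continuous_x s).const_mul V) fun x hx => ?_
        have := S.θ_pos s x
        have := (hv S hS s hs' x hx).2
        gcongr
      rw [tInt_const_mul] at this
      exact this.trans (by gcongr; exact hθ S hS s hs')
    have h3 : b ^ 2 * (tInt fun x => S.v s x * S.θ s x ^ 8) ≤ b ^ 2 * (V * C) := by gcongr
    have p1 : 0 ≤ tInt fun x => px S.q s x ^ 2 / S.v s x :=
      tInt_nonneg fun x _ => div_nonneg (sq_nonneg _) (S.v_pos s x).le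
    have p2 : 0 ≤ tInt fun x => S.v s x * S.q s x ^ 2 :=
      tInt_nonneg fun x _ => mul_nonneg (S.v_pos s x).le (sq_nonneg _)
    set I₁ := tInt fun x => px S.q s x ^ 2 / S.v s x
    set I₂ := tInt fun x => S.v s x * S.q s x ^ 2
    have q2 : 0 ≤ 2 * a * I₂ := by positivity
    have h4 : I₂ = 1 / (2 * a) * (2 * a * I₂) := by field_simp
    have h5 : 1 / (2 * a) * (2 * a * I₂) ≤ 1 / (2 * a) * (b ^ 2 * (V * C)) := by
      exact mul_le_mul_of_nonneg_left (by linarith) (by positivity)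
    rw [hL]
    linarith
  rw [intervalIntegral.integral_const, smul_eq_mul, sub_zero] at h
  exact h.trans (by gcongr; exact ht.2)

/-! ### The auxiliary functions -/

variable (S) in
theorem Y_nonneg (t : ℝ) : 0 ≤ S.Y t :=
  Real.sSup_nonneg (by
    rintro _ ⟨s, -, rfl⟩
    exact tInt_nonneg fun x _ => by positivity)

theorem accelDissip_le_Z {V : ℝ} {t : ℝ} (ht : 0 ≤ t) (hv : ∀ x ∈ cell, S.v t x ≤ V) :
    S.accelDissip t ≤ V ^ 2 * S.Z t := by
  have sm : Sm fun s x => px (px S.u) s x ^ 2 / S.v s x ^ 2 :=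
    (S.smu.px.px.pow 2).div (S.smv.pow 2) fun s x => pow_pos (S.v_pos s x) 2
  have h1 : (tInt fun x => px (px S.u) t x ^ 2 / S.v t x ^ 2) ≤ S.Z t :=
    le_csSup (isCompact_Icc.image sm.continuous_tInt).bddAbove ⟨t, right_mem_Icc.2 ht, rfl⟩
  have h2 : S.accelDissip t ≤ V ^ 2 * tInt fun x => px (px S.u) t x ^ 2 / S.v t x ^ 2 := by
    rw [← tInt_const_mul]
    refine tInt_mono ((S.smu.px.px.pow 2).continuous_x t) ((sm.continuous_x t).const_mul _)
      fun x hx => ?_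
    have hv0 := S.v_pos t x
    have hvV := hv x hx
    rw [mul_div_assoc', le_div_iff₀ (by positivity), mul_comm (V ^ 2)]
    gcongr
  exact h2.trans (by gcongr)

theorem Linf_le {f : ℝ → ℝ} {C : ℝ} (h : ∀ x ∈ cell, |f x| ≤ C) : Linf f ≤ C :=
  csSup_le (Set.Nonempty.image _ (nonempty_Icc.2 (by norm_num))) (by
    rintro _ ⟨x, hx, rfl⟩
    exact h x hx)

theorem Z_nonneg (S : Sol μ R a b κ₁ κ₂ β γ T) (t : ℝ) : 0 ≤ S.Z t :=
  Real.sSup_nonneg (by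
    rintro _ ⟨s, -, rfl⟩
    exact tInt_nonneg fun x _ => by positivity)

/-- Interpolation of `u_x` between the energy bound on `u` and the quantity `ℨ`. -/
theorem px_u_bounds (P : PosParams μ R a b κ₁ κ₂ β γ T M ε) :
    ∃ K : ℝ, 0 < K ∧ ∀ S : Sol μ R a b κ₁ κ₂ β γ T, S.Bounded M ε → ∀ t ∈ Icc 0 T,
      Real.sqrt (L2sq (px S.u t)) ≤ K * S.Z t ^ ((1 : ℝ) / 4) ∧
      Linf (px S.u t) ≤ K * S.Z t ^ ((3 : ℝ) / 8) := by
  obtain ⟨Θ, hΘ, hE⟩ := energy_bound P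
  obtain ⟨_, V, _, hV, hv⟩ := v_bounds P
  set K := 2 * (1 + Θ) * (1 + V)
  have hK1 : 1 ≤ K := by nlinarith [mul_pos hΘ hV]
  have hKΘ : Θ ≤ K := by nlinarith [mul_pos hΘ hV]
  have hKV : 2 * V ≤ K := by nlinarith [mul_pos hΘ hV]
  have hK : 0 < K := by positivity
  refine ⟨K, hK, fun S hS t ht => ?_⟩
  have hA := S.accelDissip_le_Z ht.1 fun x hx => (hv S hS t ht x hx).2
  have hZ := S.Z_nonneg t
  set z := S.Z t ^ ((1 : ℝ) / 8)
  have hz : 0 ≤ z := rpow_nonneg hZ _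
  have z8 : S.Z t = z ^ 8 := by
    rw [← rpow_mul_natCast hZ]
    norm_num
  have z2 : S.Z t ^ ((1 : ℝ) / 4) = z ^ 2 := by
    rw [← rpow_mul_natCast hZ]
    norm_num
  have z3 : S.Z t ^ ((3 : ℝ) / 8) = z ^ 3 := by
    rw [← rpow_mul_natCast hZ]
    norm_num
  rw [z8] at hA
  rw [z2, z3]
  set A := S.accelDissip t with hAdef
  set G := tInt fun x => px S.u t x ^ 2 with hGdef
  have hA0 : 0 ≤ A := tInt_nonneg fun x _ => sq_nonneg _
  have hG : G ≤ (K * z ^ 2) ^ 2 := by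
    refine le_of_sq_le_sq ?_ (by positivity)
    calc G ^ 2 ≤ (tInt fun x => S.u t x ^ 2) * A := S.tInt_px_u_sq_sq_le t
      _ ≤ K ^ 2 * (K ^ 2 * z ^ 8) := by
        have h1 : (tInt fun x => S.u t x ^ 2) ≤ K ^ 2 := by nlinarith [(hE S hS t ht).2]
        have h2 : V ^ 2 * z ^ 8 ≤ K ^ 2 * z ^ 8 := by
          gcongr
          linarith
        exact mul_le_mul h1 (hA.trans h2) hA0 (by positivity)
      _ = ((K * z ^ 2) ^ 2) ^ 2 := by ring
  refine ⟨Real.sqrt_le_iff.2 ⟨by positivity, hG⟩, Linf_le fun x hx => ?_⟩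
  refine le_of_pow_le_pow_left₀ (n := 4) (by norm_num) (by positivity) ?_
  calc |px S.u t x| ^ 4 = px S.u t x ^ 4 := (by decide : Even 4).pow_abs _
    _ ≤ 4 * (G * A) := S.px_u_pow_four_le t hx
    _ ≤ 4 * ((K * z ^ 2) ^ 2 * (V ^ 2 * z ^ 8)) := by gcongr
    _ = (2 * V) ^ 2 * (K ^ 2 * z ^ 12) := by ring
    _ ≤ K ^ 2 * (K ^ 2 * z ^ 12) := by gcongr
    _ = (K * z ^ 3) ^ 4 := by ring

end Sol

end RadHydro

open RadHydro

theorem stmt_11 (μ R a b κ₁ κ₂ β γ : ℝ)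
    (hμ : 0 < μ) (hR : 0 < R) (ha : 0 < a) (hb : 0 < b)
    (hκ₁ : 0 < κ₁) (hκ₂ : 0 < κ₂) (hβ : 0 < β) (hγ : 1 < γ)
    (T M ε : ℝ) (hT : 0 < T) (hM : 1 ≤ M) (hε0 : 0 < ε) (hε1 : ε ≤ 1)
    (n : ℝ) (hn : 8 ≤ n) :
    ∃ C : ℝ, 0 < C ∧
      ∀ S : Sol μ R a b κ₁ κ₂ β γ T, S.Bounded M ε →
        ∀ t ∈ Icc (0 : ℝ) T,
          Linf (S.v t) ≤ C * (1 + S.Y t ^ T0 n 1 β) ∧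
          Real.sqrt (L2sq (px S.u t)) ≤ C * (1 + S.Y t ^ T0 n (1/2) β) * S.Z t ^ ((1:ℝ)/4) ∧
          Linf (px S.u t) ≤ C * (1 + S.Y t ^ T0 n (3/4) β) * S.Z t ^ ((3:ℝ)/8) ∧
          L2sq (S.u t) + (∫ s in (0 : ℝ)..t, tInt fun x => (px S.u s x) ^ 2 / S.v s x)
            ≤ C * (1 + S.Y t ^ T0 n 1 β) ∧
          (∫ s in (0 : ℝ)..t, (tInt fun x => (px S.q s x) ^ 2 / S.v s x)
              + tInt fun x => S.v s x * (S.q s x) ^ 2)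
            ≤ C * (1 + S.Y t ^ T0 n 8 β) ∧
          L2sq (S.θ t) + (∫ s in (0 : ℝ)..t, tInt fun x =>
              kappa κ₁ κ₂ β (S.v s x) (S.θ s x) * (px S.θ s x) ^ 2 / S.v s x)
            ≤ C * (1 + S.Y t ^ T1 n β) := by
  have P : PosParams μ R a b κ₁ κ₂ β γ T M ε := ⟨hμ, hR, ha, hb, hκ₁, hκ₂, hβ, hγ, hT, hM, hε0⟩
  obtain ⟨Θ, hΘ, hE⟩ := Sol.energy_bound P
  obtain ⟨_, V, _, hV, hv⟩ := Sol.v_bounds P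
  obtain ⟨K, hK, hu⟩ := Sol.px_u_bounds P
  obtain ⟨D, hD, hdis⟩ := Sol.integral_dissip_le P
  obtain ⟨Q, hQ, hq⟩ := Sol.integral_radiation_le P
  obtain ⟨H, hH, hgrad⟩ := Sol.gradient_bounds P
  set C := Θ + V + K + D + Q + 2 * H with hC
  have hC0 : 0 < C := by positivity
  refine ⟨C, hC0, fun S hS t ht => ?_⟩
  have hY : ∀ p : ℝ, C ≤ C * (1 + S.Y t ^ p) := fun p =>
    le_mul_of_one_le_right hC0.le (le_add_of_nonneg_right (rpow_nonneg (S.Y_nonneg t) p))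
  have hZ := S.Z_nonneg t
  obtain ⟨hu2, huinf⟩ := hu S hS t ht
  obtain ⟨-, hθ, -, hheat⟩ := hgrad S hS t ht
  have hdis := hdis S hS t ht
  have hu0 := (hE S hS t ht).2
  have hKC : K ≤ C := by linarith
  refine ⟨?_, ?_, ?_, ?_, ?_, ?_⟩
  · refine le_trans (Sol.Linf_le fun x hx => ?_) (hY _)
    rw [abs_of_pos (S.v_pos t x)]
    linarith [(hv S hS t ht x hx).2]
  · exact hu2.trans (mul_le_mul_of_nonneg_right (hKC.trans (hY _)) (rpow_nonneg hZ _))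
  · exact huinf.trans (mul_le_mul_of_nonneg_right (hKC.trans (hY _)) (rpow_nonneg hZ _))
  · exact (add_le_add hu0 hdis).trans (le_trans (by linarith) (hY _))
  · exact (hq S hS t ht).trans (le_trans (by linarith) (hY _))
  · exact (add_le_add hθ hheat).trans (le_trans (by linarith) (hY _))
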